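/- Let A be a real Baer von Neumann regular poring. Then A has a unique real closure * if and only if there exists a subset X ⊆ Sper A such that, for every epof B of A and every ideal I of B making A → B → B/I an essential extension of A, one has X = {α ∈ Sper A : ρ(α) is (A/supp(α))-isomorphic to the integral closure of A/supp(α) in B/p for some prime ideal p of B containing I and the ideal generated by supp(α)}. -/

import Mathlib

universe u

/-- A partial ordering (positive cone) of a commutative ring: closed under addition and
multiplication, contains all squares, and intersects its negative only in `0`. -/
def IsPartialOrdering {A : Type*} [CommRing A] (P : Set A) : Prop :=
  (∀ a ∈ P, ∀ b ∈ P, a + b ∈ P) ∧ (∀ a ∈ P, ∀ b ∈ P, a * b ∈ P) ∧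
  (∀ a : A, a ^ 2 ∈ P) ∧ (∀ a ∈ P, -a ∈ P → a = 0)

/-- A (formally) real ring: a sum of squares vanishes only if each term vanishes. -/
def IsRealRing (A : Type*) [CommRing A] : Prop :=
  ∀ (n : ℕ) (f : Fin n → A), (∑ i, f i ^ 2) = 0 → ∀ i, f i = 0

/-- A von Neumann regular commutative ring. -/
def IsVonNeumannRegular (A : Type*) [CommRing A] : Prop :=
  ∀ a : A, ∃ b : A, a = a ^ 2 * b

/-- A Baer ring: the annihilator of every subset is generated by an idempotent. -/
def IsBaerRing (A : Type*) [CommRing A] : Prop :=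
  ∀ S : Set A, ∃ e : A, e * e = e ∧ ∀ x : A, (∀ s ∈ S, x * s = 0) ↔ ∃ y : A, x = e * y

/-- An essential (ring) extension: an injective ring homomorphism such that every nonzero
ideal of the codomain meets the image of the domain nontrivially. -/
def IsEssentialExtension {A B : Type*} [CommRing A] [CommRing B] (f : A →+* B) : Prop :=
  Function.Injective f ∧ ∀ J : Ideal B, J ≠ ⊥ → ∃ a : A, f a ∈ J ∧ f a ≠ 0

/-- A real ring is real closed * if it admits no proper essential integral extension
which is again a real ring. -/
def IsRealClosedStar (B : Type u) [CommRing B] : Prop :=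
  IsRealRing B ∧ ∀ (C : Type u) [CommRing C] (f : B →+* C),
    IsRealRing C → IsEssentialExtension f → f.IsIntegral → Function.Surjective f

/-- `(B, Q)` together with the embedding `f` is a real closure * of the poring `(A, P)`:
`B` is a real closed * ring, an essential and integral extension of `A`, whose partial
ordering `Q` extends `P`. -/
structure IsRealClosureStarOf (A : Type u) [CommRing A] (P : Set A)
    (B : Type u) [CommRing B] (Q : Set B) (f : A →+* B) : Prop where
  pos_partial : IsPartialOrdering Q
  rcs : IsRealClosedStar B
  essential : IsEssentialExtension f
  integral : f.IsIntegral
  mono : ∀ a ∈ P, f a ∈ Q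

/-- Bundled real closure * of a poring `(A, P)`. -/
structure RealClosureStar (A : Type u) [CommRing A] (P : Set A) : Type (u + 1) where
  carrier : Type u
  [ring : CommRing carrier]
  pos : Set carrier
  emb : A →+* carrier
  is : IsRealClosureStarOf A P carrier pos emb

attribute [instance] RealClosureStar.ring

/-- Two real closures * of `(A, P)` are `A`-isomorphic: there is a ring isomorphism over
`A` preserving the partial orderings in both directions. -/
def RealClosureStar.AIso {A : Type u} [CommRing A] {P : Set A}
    (B C : RealClosureStar A P) : Prop :=
  ∃ e : B.carrier ≃+* C.carrier, (∀ a : A, e (B.emb a) = C.emb a) ∧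
    ∀ b : B.carrier, b ∈ B.pos ↔ e b ∈ C.pos

/-- A poring `(A, P)` has a unique real closure *: one exists, and any two are
`A`-isomorphic as porings. -/
def HasUniqueRealClosureStar (A : Type u) [CommRing A] (P : Set A) : Prop :=
  Nonempty (RealClosureStar A P) ∧ ∀ B C : RealClosureStar A P, B.AIso C

/-- A prime cone of a commutative ring. -/
structure PrimeCone (A : Type u) [CommRing A] : Type u where
  carrier : Set A
  add_mem : ∀ a ∈ carrier, ∀ b ∈ carrier, a + b ∈ carrier
  mul_mem : ∀ a ∈ carrier, ∀ b ∈ carrier, a * b ∈ carrier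
  sq_mem : ∀ a : A, a ^ 2 ∈ carrier
  mem_or_neg_mem : ∀ a : A, a ∈ carrier ∨ -a ∈ carrier
  support : Ideal A
  mem_support : ∀ a : A, a ∈ support ↔ a ∈ carrier ∧ -a ∈ carrier
  support_isPrime : support.IsPrime

/-- The real spectrum of a poring `(A, P)`: the prime cones containing `P`. -/
def RealSpectrum (A : Type u) [CommRing A] (P : Set A) : Type u :=
  {α : PrimeCone A // P ⊆ α.carrier}

/-- A real closed field: formally real, every element or its negative is a square, and
every polynomial of odd degree has a root. -/
def IsRealClosedField (F : Type u) [Field F] : Prop :=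
  IsRealRing F ∧ (∀ x : F, (∃ y : F, y ^ 2 = x) ∨ ∃ y : F, y ^ 2 = -x) ∧
    ∀ p : Polynomial F, Odd p.natDegree → ∃ x : F, Polynomial.eval x p = 0

/-- A total ordering (positive cone) of a ring. -/
def IsTotalOrderingCone {K : Type*} [CommRing K] (T : Set K) : Prop :=
  (∀ a ∈ T, ∀ b ∈ T, a + b ∈ T) ∧ (∀ a ∈ T, ∀ b ∈ T, a * b ∈ T) ∧
  (∀ x : K, x ∈ T ∨ -x ∈ T) ∧ ∀ x ∈ T, -x ∈ T → x = 0

/-- The data `(K, κ)` is an epof (extension of product of fields) of the poring `(A, P)`: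
for each prime `p` of `A`, `K p` is a real closed field, algebraic over `Frac (A / p)`
(i.e. every element is algebraic over the image of `A` under `κ p`, whose kernel is `p`),
whose unique ordering (the squares) extends the image of `P` in `A / p`.  The epof itself
is the product `∀ p, K p` with the embedding `Pi.ringHom κ` and partial ordering the
squares. -/
structure IsEpof (A : Type u) [CommRing A] (P : Set A)
    (K : PrimeSpectrum A → Type u) [∀ p, Field (K p)] (κ : ∀ p, A →+* K p) : Prop where
  ker : ∀ (p : PrimeSpectrum A) (a : A), κ p a = 0 ↔ a ∈ p.asIdeal
  rcf : ∀ p, IsRealClosedField (K p)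
  alg : ∀ (p) (x : K p), ∃ q : Polynomial A,
    Polynomial.eval₂ (κ p) x q = 0 ∧ q.map (κ p) ≠ 0
  ordext : ∀ p, ∀ a ∈ P, ∃ y : K p, y ^ 2 = κ p a

/-- Witness that `ρ(α)` — the real closure of `Frac (A / supp α)` with the ordering
induced by `α` — is `A / supp α`-isomorphic to the integral closure of (the image of)
`A / supp α` in `D`, where `h : A →+* D`.  The field `F` together with `j` is a copy of
`ρ(α)`: a real closed field, algebraic over the image of `A`, whose ordering induces `α`
on `A`; `e` embeds it into `D` over `A` with image the integral closure. -/
structure RhoIsoIntegralClosure (A : Type u) [CommRing A] (α : PrimeCone A)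
    (D : Type u) [CommRing D] (h : A →+* D) : Type (u + 1) where
  F : Type u
  [fieldF : Field F]
  j : A →+* F
  rcf : IsRealClosedField F
  ord : ∀ a : A, (∃ y : F, y ^ 2 = j a) ↔ a ∈ α.carrier
  alg : ∀ x : F, ∃ q : Polynomial A, Polynomial.eval₂ j x q = 0 ∧ q.map j ≠ 0
  e : F →+* D
  comm : ∀ a : A, e (j a) = h a
  range_ic : Set.range e = {x : D | h.IsIntegralElem x}

section

open Polynomial

namespace IsRealClosed

theorem algebraMap_surjective_of_odd_finrank {R M : Type*} [Field R] [IsRealClosed R] [Field M]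
    [Algebra R M] (h : Odd (Module.finrank R M)) : Function.Surjective (algebraMap R M) := by
  intro x
  have : FiniteDimensional R M := Module.finite_of_finrank_pos h.pos
  have hx : IsIntegral R x := Algebra.IsIntegral.isIntegral x
  have hodd : Odd (minpoly R x).natDegree := h.of_dvd_nat (minpoly.degree_dvd hx)
  obtain ⟨r, hr⟩ := exists_isRoot_of_odd_natDegree hodd
  exact minpoly.mem_range_of_degree_eq_one R x
    (degree_eq_one_of_irreducible_of_root (minpoly.irreducible hx) hr)

theorem isPGroup_two_gal (R N : Type*) [Field R] [IsRealClosed R] [Field N]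
    [Algebra R N] [FiniteDimensional R N] [IsGalois R N] : IsPGroup 2 Gal(N/R) := by
  let P : Sylow 2 Gal(N/R) := default
  have h1 : Module.finrank R (IntermediateField.fixedField (P : Subgroup Gal(N/R))) =
      (P : Subgroup Gal(N/R)).index := by
    have h2 := Module.finrank_mul_finrank R
      (IntermediateField.fixedField (P : Subgroup Gal(N/R))) N
    rw [IntermediateField.finrank_fixedField_eq_card, ← IsGalois.card_aut_eq_finrank R N,
      ← (P : Subgroup Gal(N/R)).index_mul_card] at h2
    exact Nat.eq_of_mul_eq_mul_right Nat.card_pos h2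
  have h3 : Odd (Module.finrank R (IntermediateField.fixedField (P : Subgroup Gal(N/R)))) := by
    rw [h1, ← Nat.not_even_iff_odd, even_iff_two_dvd]
    exact P.not_dvd_index
  have h4 : IntermediateField.fixedField (P : Subgroup Gal(N/R)) = ⊥ := by
    rw [eq_bot_iff]
    intro x hx
    obtain ⟨r, hr⟩ := algebraMap_surjective_of_odd_finrank h3 ⟨x, hx⟩
    exact IntermediateField.mem_bot.mpr ⟨r, congrArg Subtype.val hr⟩
  have h5 : (P : Subgroup Gal(N/R)) = ⊤ := by
    rw [← IntermediateField.fixingSubgroup_fixedField (P : Subgroup Gal(N/R)), h4,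
      IntermediateField.fixingSubgroup_bot]
  have := P.isPGroup'
  rw [h5] at this
  exact this.of_equiv Subgroup.topEquiv

theorem exists_sq_eq_neg_one_of_finrank_eq_two {R M : Type*} [Field R] [IsRealClosed R] [Field M]
    [Algebra R M] (h : Module.finrank R M = 2) : ∃ x : M, x ^ 2 = -1 := by
  have : FiniteDimensional R M := Module.finite_of_finrank_pos (by omega)
  have hns : ¬ Function.Surjective (algebraMap R M) := by
    intro hs
    have : Module.finrank R M = Module.finrank R R :=
      (LinearEquiv.ofBijective (Algebra.linearMap R M)
        ⟨(algebraMap R M).injective, hs⟩).finrank_eq.symm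
    simp [h] at this
  obtain ⟨x, hx⟩ := not_forall.mp hns
  have hxi : IsIntegral R x := Algebra.IsIntegral.isIntegral x
  have hd : (minpoly R x).natDegree = 2 := by
    have h1 := minpoly.degree_dvd hxi
    rw [h, Nat.dvd_prime Nat.prime_two] at h1
    refine h1.resolve_left fun h2 ↦ hx ?_
    exact minpoly.mem_range_of_degree_eq_one R x
      ((degree_eq_iff_natDegree_eq_of_pos one_pos).mpr h2)
  set c := (minpoly R x).coeff 0
  set b := (minpoly R x).coeff 1
  have hq : x ^ 2 + algebraMap R M b * x + algebraMap R M c = 0 := by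
    have h1 := minpoly.aeval R x
    have h2 : (minpoly R x).coeff 2 = 1 := by
      have := minpoly.monic hxi
      rwa [Monic, leadingCoeff, hd] at this
    rw [aeval_eq_sum_range, hd] at h1
    simp only [Finset.sum_range_succ, Finset.sum_range_zero, Algebra.smul_def, h2] at h1
    simp only [map_one] at h1
    linear_combination h1
  have hc2 : (2 : M) ≠ 0 := by
    have : (2 : R) ≠ 0 := two_ne_zero
    rw [← map_ofNat (algebraMap R M) 2]
    exact (_root_.map_ne_zero (algebraMap R M)).mpr this
  have hy : (2 * x + algebraMap R M b) ^ 2 = algebraMap R M (b ^ 2 - 4 * c) := by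
    simp only [map_sub, map_pow, map_mul, map_ofNat]
    linear_combination 4 * hq
  have key : ∀ s : R, 2 * x + algebraMap R M b ≠ algebraMap R M s := by
    intro s hs
    refine hx ⟨(s - b) / 2, ?_⟩
    rw [map_div₀, map_sub, map_ofNat, ← hs]
    field_simp
    ring
  rcases isSquare_or_isSquare_neg (b ^ 2 - 4 * c) with ⟨s, hs⟩ | ⟨s, hs⟩
  · rw [hs, map_mul, ← sq] at hy
    rcases sq_eq_sq_iff_eq_or_eq_neg.mp hy with h1 | h1
    · exact (key s h1).elim
    · exact (key (-s) (by rw [h1, map_neg])).elim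
  · have hs0 : algebraMap R M s ≠ 0 := by
      intro h0
      have : s = 0 := by simpa using h0
      rw [this, mul_zero, neg_eq_zero] at hs
      refine key 0 ?_
      simpa [hs] using hy
    refine ⟨(2 * x + algebraMap R M b) / algebraMap R M s, ?_⟩
    rw [div_pow, hy, div_eq_iff (pow_ne_zero _ hs0), ← map_pow, neg_one_mul, ← map_neg]
    congr 1
    linear_combination -hs

theorem exists_sq_eq_neg_one_of_ne_bot {R N : Type*} [Field R] [IsRealClosed R] [Field N]
    [Algebra R N] [FiniteDimensional R N] [IsGalois R N] (M : IntermediateField R N)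
    (hM : M ≠ ⊥) : ∃ x ∈ M, x ^ 2 = -1 := by
  have hG := isPGroup_two_gal R N
  obtain ⟨n, hn⟩ := IsPGroup.iff_card.mp hG
  obtain ⟨m, hm⟩ := IsPGroup.iff_card.mp (hG.to_subgroup M.fixingSubgroup)
  have hmn : m < n := by
    rw [← Nat.pow_lt_pow_iff_right (a := 2) (by norm_num), ← hm, ← hn]
    refine lt_of_le_of_ne (Subgroup.card_le_card_group _) fun h ↦ hM ?_
    rw [← IsGalois.fixedField_fixingSubgroup M, Subgroup.eq_top_of_card_eq _ h,
      ← IntermediateField.fixingSubgroup_bot, IsGalois.fixedField_fixingSubgroup]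
  obtain ⟨K, hK, hKM⟩ := Sylow.exists_subgroup_card_pow_prime_le 2 (m := n - 1)
    (by rw [hn]; exact pow_dvd_pow _ (by omega)) M.fixingSubgroup hm (by omega)
  have hle : IntermediateField.fixedField K ≤ M := by
    rw [← IsGalois.fixedField_fixingSubgroup M]
    exact IntermediateField.fixedField_antitone hKM
  have h2 : Module.finrank R (IntermediateField.fixedField K) = 2 := by
    have h2 := Module.finrank_mul_finrank R (IntermediateField.fixedField K) N
    rw [IntermediateField.finrank_fixedField_eq_card, ← IsGalois.card_aut_eq_finrank R N,
      hn, hK] at h2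
    refine Nat.eq_of_mul_eq_mul_right (Nat.two_pow_pos (n - 1)) (h2.trans ?_)
    rw [← pow_succ']
    congr 1
    omega
  obtain ⟨x, hx⟩ := exists_sq_eq_neg_one_of_finrank_eq_two h2
  exact ⟨x, hle x.2, by simpa using congrArg Subtype.val hx⟩

/-- A real closed field has no proper algebraic extension in which `-1` is not a square. -/
theorem ringHom_surjective_of_forall_sq_ne_neg_one {R L : Type*} [Field R] [IsRealClosed R]
    [Field L] (j : R →+* L) (hj : j.IsIntegral) (hL : ∀ x : L, x ^ 2 ≠ -1) :
    Function.Surjective j := by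
  let := j.toAlgebra
  intro θ
  have hθ : IsIntegral R θ := hj θ
  by_contra hns
  let N := (minpoly R θ).SplittingField
  have : IsGalois R N := IsGalois.of_separable_splitting_field (minpoly.irreducible hθ).separable
  have hdeg : (minpoly R θ).degree ≠ 0 := (minpoly.degree_pos hθ).ne'
  obtain ⟨θ', hθ'⟩ := (SplittingField.splits (minpoly R θ)).exists_eval_eq_zero
    (by rwa [degree_map])
  have hroot : aeval θ' (minpoly R θ) = 0 := by rwa [aeval_def, ← eval_map]
  have hmin : minpoly R θ' = minpoly R θ :=
    (minpoly.eq_of_irreducible_of_monic (minpoly.irreducible hθ) hroot (minpoly.monic hθ)).symm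
  have hθ'i : IsIntegral R θ' := ⟨_, minpoly.monic hθ, hroot⟩
  have hne : IntermediateField.adjoin R {θ'} ≠ ⊥ := by
    intro h
    rw [IntermediateField.adjoin_simple_eq_bot_iff, IntermediateField.mem_bot] at h
    obtain ⟨r, hr⟩ := h
    have h1 := minpoly.eq_X_sub_C N r
    rw [hr, hmin] at h1
    refine hns ⟨r, ?_⟩
    have h2 := minpoly.aeval R θ
    rw [h1, map_sub, aeval_X, aeval_C, sub_eq_zero] at h2
    exact h2.symm
  obtain ⟨x, hx, hx2⟩ := exists_sq_eq_neg_one_of_ne_bot _ hne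
  let φ : IntermediateField.adjoin R {θ'} →ₐ[R] L :=
    (IntermediateField.adjoin.powerBasis hθ'i).lift θ (by
      rw [IntermediateField.adjoin.powerBasis_gen, IntermediateField.minpoly_gen, hmin,
        minpoly.aeval])
  refine hL (φ ⟨x, hx⟩) ?_
  rw [← map_pow, ← map_one φ, ← map_neg]
  exact congrArg φ (Subtype.ext hx2)

end IsRealClosed

/-- In a field where every element or its negative is a square, but `-1` is not a sum of squares,
the squares are the nonnegative elements of a linear order. -/
theorem exists_linearOrder_of_isSquare_or_isSquare_neg {F : Type*} [Field F] [IsSemireal F]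
    (h : ∀ x : F, IsSquare x ∨ IsSquare (-x)) :
    ∃ _ : LinearOrder F, IsStrictOrderedRing F := by
  classical
  let C : RingCone F :=
    { Subsemiring.sumSq F with
      eq_zero_of_mem_of_neg_mem' := by
        intro a ha ha'
        by_contra h0
        refine IsSemireal.not_isSumSq_neg_one F ?_
        have h1 : IsSumSq (-a * a * (a⁻¹ * a⁻¹)) :=
          ((Subsemiring.mem_sumSq.mp ha').mul (Subsemiring.mem_sumSq.mp ha)).mul (.mul_self _)
        have h2 : -a * a * (a⁻¹ * a⁻¹) = -1 := by field_simp
        rwa [h2] at h1 }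
  have : HasMemOrNegMem C := ⟨fun a ↦ (h a).imp (fun h ↦ Subsemiring.mem_sumSq.mpr h.isSumSq)
    (fun h ↦ Subsemiring.mem_sumSq.mpr h.isSumSq)⟩
  let l : LinearOrder F := LinearOrder.mkOfAddGroupCone C
  have h1 : IsOrderedRing F := IsOrderedRing.mkOfCone C
  exact ⟨l, inferInstance⟩

theorem IsRealClosed.exists_linearOrder (F : Type*) [Field F] [IsRealClosed F] :
    ∃ _ : LinearOrder F, IsStrictOrderedRing F :=
  exists_linearOrder_of_isSquare_or_isSquare_neg IsRealClosed.isSquare_or_isSquare_neg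

theorem IsSumSq.map_ringHom {R S : Type*} [CommRing R] [CommRing S] (f : R →+* S) {s : R}
    (hs : IsSumSq s) : IsSumSq (f s) := by
  induction hs with
  | zero => simp
  | sq_add a _ ih => rw [map_add, map_mul]; exact .sq_add _ ih

theorem AdjoinRoot.exists_isSumSq_of_isSumSq {k : Type*} [Field k] {f : k[X]}
    (hf : f.natDegree ≠ 0) {x : AdjoinRoot f} (hx : IsSumSq x) :
    ∃ s : k[X], IsSumSq s ∧ s.natDegree ≤ 2 * (f.natDegree - 1) ∧ AdjoinRoot.mk f s = x := by
  induction hx with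
  | zero => exact ⟨0, .zero, by simp, by simp⟩
  | @sq_add a t ht ih =>
    obtain ⟨s, hs, hd, rfl⟩ := ih
    obtain ⟨g, rfl⟩ := AdjoinRoot.mk_surjective a
    refine ⟨g % f * (g % f) + s, .sq_add _ hs, ?_, ?_⟩
    · refine (natDegree_add_le _ _).trans (max_le ?_ hd)
      have := natDegree_mod_lt g hf
      refine natDegree_mul_le.trans ?_
      omega
    · have : AdjoinRoot.mk f (g % f) = AdjoinRoot.mk f g := by
        rw [AdjoinRoot.mk_eq_mk, EuclideanDomain.mod_eq_sub_mul_div]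
        exact ⟨-(g / f), by ring⟩
      rw [map_add, map_mul, this]

/-- The intermediate value property for polynomials over an ordered field. -/
def PolynomialIVP (k : Type*) [Field k] [LinearOrder k] : Prop :=
  ∀ (f : k[X]) (a b : k), a < b → f.eval a * f.eval b < 0 → ∃ r, a < r ∧ r < b ∧ f.IsRoot r

section Ordered

variable {k : Type*} [Field k] [LinearOrder k] [IsStrictOrderedRing k]

theorem polynomialIVP_of_forall_irreducible
    (H : ∀ f : k[X], Irreducible f → ¬ IsSumSq (-1 : AdjoinRoot f) → ∃ r, f.IsRoot r) :
    PolynomialIVP k := by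
  intro f a b hab
  induction hn : f.natDegree using Nat.strong_induction_on generalizing f with
  | _ n ih =>
  intro hf
  have hdeg : f.natDegree ≠ 0 := by
    intro h
    rw [eq_C_of_natDegree_eq_zero h, eval_C, eval_C] at hf
    exact (mul_self_nonneg _).not_gt hf
  have hf0 : f ≠ 0 := by rintro rfl; simp at hdeg
  by_cases hirr : Irreducible f
  · by_cases hs : IsSumSq (-1 : AdjoinRoot f)
    · obtain ⟨s, hs, hd, hmk⟩ := AdjoinRoot.exists_isSumSq_of_isSumSq hdeg hs
      have hdvd : f ∣ s + 1 := by
        rw [← AdjoinRoot.mk_eq_zero, map_add, hmk, map_one, neg_add_cancel]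
      obtain ⟨h, hh⟩ := hdvd
      have hpos : ∀ r : k, 0 < f.eval r * h.eval r := by
        intro r
        rw [← eval_mul, ← hh, eval_add, eval_one]
        have : 0 ≤ s.eval r := (hs.map_ringHom (evalRingHom r)).nonneg
        linarith
      have hh0 : h ≠ 0 := by
        rintro rfl
        simpa using hpos 0
      have hlt : h.natDegree < n := by
        have h1 := congrArg natDegree hh
        rw [natDegree_mul hf0 hh0] at h1
        have h2 : (s + 1).natDegree ≤ 2 * (f.natDegree - 1) :=
          (natDegree_add_le _ _).trans (by simpa using hd)
        omega
      have hsign : h.eval a * h.eval b < 0 := by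
        have := mul_pos (hpos a) (hpos b)
        by_contra! hc
        nlinarith [mul_nonneg hc (neg_nonneg.mpr hf.le)]
      obtain ⟨r, -, -, hr⟩ := ih _ hlt h rfl hsign
      have := hpos r
      rw [hr.eq_zero, mul_zero] at this
      exact (lt_irrefl _ this).elim
    · obtain ⟨r, hr⟩ := H f hirr hs
      have h1 : f.natDegree = 1 :=
        natDegree_eq_of_degree_eq_some (degree_eq_one_of_irreducible_of_root hirr hr)
      obtain ⟨g, hg⟩ := dvd_iff_isRoot.mpr hr
      have hg0 : g ≠ 0 := by rintro rfl; simp [hf0] at hg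
      have hgd : g.natDegree = 0 := by
        have := congrArg natDegree hg
        rw [natDegree_mul (X_sub_C_ne_zero r) hg0, natDegree_X_sub_C, h1] at this
        omega
      rw [eq_C_of_natDegree_eq_zero hgd] at hg
      rw [hg] at hf
      simp only [eval_mul, eval_sub, eval_X, eval_C] at hf
      have h2 : (a - r) * (b - r) < 0 := by
        by_contra! hc
        nlinarith [mul_nonneg hc (mul_self_nonneg (g.coeff 0))]
      refine ⟨r, ?_, ?_, hr⟩
      · by_contra! hc
        nlinarith
      · by_contra! hc
        nlinarith
  · rw [irreducible_iff] at hirr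
    push Not at hirr
    obtain ⟨g, h, hgh, hg, hh⟩ :=
      hirr fun hu ↦ hdeg (natDegree_eq_zero_of_isUnit hu)
    have hg0 : g ≠ 0 := by rintro rfl; simp [hf0] at hgh
    have hh0 : h ≠ 0 := by rintro rfl; simp [hf0] at hgh
    have hgd : g.natDegree ≠ 0 := fun h0 ↦ hg (isUnit_iff_degree_eq_zero.mpr
      (by rw [degree_eq_natDegree hg0, h0]; rfl))
    have hhd : h.natDegree ≠ 0 := fun h0 ↦ hh (isUnit_iff_degree_eq_zero.mpr
      (by rw [degree_eq_natDegree hh0, h0]; rfl))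
    have hd := congrArg natDegree hgh
    rw [natDegree_mul hg0 hh0] at hd
    rw [hgh, eval_mul, eval_mul] at hf
    have : g.eval a * g.eval b < 0 ∨ h.eval a * h.eval b < 0 := by
      by_contra! hc
      nlinarith [mul_nonneg hc.1 hc.2]
    rcases this with h1 | h1
    · obtain ⟨r, h2, h3, h4⟩ := ih _ (by omega) g rfl h1
      exact ⟨r, h2, h3, by rw [hgh, IsRoot, eval_mul, h4.eq_zero, zero_mul]⟩
    · obtain ⟨r, h2, h3, h4⟩ := ih _ (by omega) h rfl h1
      exact ⟨r, h2, h3, by rw [hgh, IsRoot, eval_mul, h4.eq_zero, mul_zero]⟩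

theorem IsRealClosed.polynomialIVP [IsRealClosed k] : PolynomialIVP k := by
  refine polynomialIVP_of_forall_irreducible fun f hf hs ↦ ?_
  have : Fact (Irreducible f) := ⟨hf⟩
  have hint : (AdjoinRoot.of f).IsIntegral := by
    have : FiniteDimensional k (AdjoinRoot f) := (AdjoinRoot.powerBasis hf.ne_zero).finite
    exact (algebraMap_isIntegral_iff (A := AdjoinRoot f)).mpr inferInstance
  obtain ⟨r, hr⟩ := ringHom_surjective_of_forall_sq_ne_neg_one (AdjoinRoot.of f) hint
    (fun x hx ↦ hs (by rw [← hx, sq]; exact .mul_self x)) (AdjoinRoot.root f)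
  refine ⟨r, ?_⟩
  have h1 := AdjoinRoot.eval₂_root f
  rw [← hr, eval₂_at_apply] at h1
  exact (map_eq_zero _).mp h1

/-- A bound beyond which `f` is positive, stable under extension of the ordered field. -/
theorem Polynomial.Monic.exists_forall_eval₂_pos {f : k[X]} (hf : f.Monic) :
    ∃ M : k, ∀ {F : Type*} [Field F] [LinearOrder F] [IsStrictOrderedRing F] (σ : k →+* F),
      StrictMono σ → ∀ x, σ M ≤ x → 0 < f.eval₂ σ x := by
  refine ⟨1 + ∑ i ∈ Finset.range f.natDegree, |f.coeff i|, ?_⟩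
  intro F _ _ _ σ hσ x hx
  have habs : ∀ y, σ |y| = |σ y| := by
    intro y
    rcases abs_cases y with ⟨h1, h2⟩ | ⟨h1, h2⟩
    · rw [h1, abs_of_nonneg]; simpa using hσ.monotone h2
    · rw [h1, map_neg, abs_of_neg]; simpa using hσ h2
  simp only [map_add, map_one, map_sum, habs] at hx
  have hx1 : 1 ≤ x := by
    have : 0 ≤ ∑ i ∈ Finset.range f.natDegree, |σ (f.coeff i)| :=
      Finset.sum_nonneg fun _ _ ↦ abs_nonneg _
    linarith
  rcases Nat.eq_zero_or_pos f.natDegree with h0 | h0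
  · rw [hf.natDegree_eq_zero.mp h0]; simp
  rw [eval₂_eq_sum_range, Finset.sum_range_succ, hf.coeff_natDegree, map_one, one_mul]
  have h1 : -((∑ i ∈ Finset.range f.natDegree, |σ (f.coeff i)|) * x ^ (f.natDegree - 1)) ≤
      ∑ i ∈ Finset.range f.natDegree, σ (f.coeff i) * x ^ i := by
    rw [Finset.sum_mul, ← Finset.sum_neg_distrib]
    refine Finset.sum_le_sum fun i hi ↦ ?_
    rw [Finset.mem_range] at hi
    have h2 : x ^ i ≤ x ^ (f.natDegree - 1) := pow_le_pow_right₀ hx1 (by omega)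
    have h3 : 0 ≤ x ^ i := by positivity
    have h4 := mul_le_mul_of_nonneg_left h2 (abs_nonneg (σ (f.coeff i)))
    have h5 := mul_le_mul_of_nonneg_right (neg_abs_le (σ (f.coeff i))) h3
    linarith
  have h2 : x ^ f.natDegree = x * x ^ (f.natDegree - 1) := by
    rw [← pow_succ']; congr 1; omega
  have h3 : 0 < x ^ (f.natDegree - 1) := by positivity
  rw [h2]
  nlinarith

theorem Polynomial.exists_forall_root_mem_Ioo {f : k[X]} (hf : f ≠ 0) :
    ∃ M : k, ∀ {F : Type*} [Field F] [LinearOrder F] [IsStrictOrderedRing F] (σ : k →+* F),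
      StrictMono σ → ∀ x, f.eval₂ σ x = 0 → σ (-M) < x ∧ x < σ M := by
  obtain ⟨M₁, h₁⟩ := (monic_mul_leadingCoeff_inv hf).exists_forall_eval₂_pos
  have hf' : f.comp (-X) ≠ 0 := fun h ↦ hf (by simpa [comp_assoc] using congrArg (comp · (-X)) h)
  obtain ⟨M₂, h₂⟩ := (monic_mul_leadingCoeff_inv hf').exists_forall_eval₂_pos
  refine ⟨max M₁ M₂, fun σ hσ x hx ↦ ⟨?_, ?_⟩⟩
  · by_contra! hc
    have h3 := h₂ σ hσ (-x) (by
      rw [map_neg] at hc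
      have := hσ.monotone (le_max_right M₁ M₂)
      linarith)
    rw [eval₂_mul, eval₂_comp, eval₂_neg, eval₂_X, neg_neg, hx, zero_mul] at h3
    exact lt_irrefl _ h3
  · by_contra! hc
    have h3 := h₁ σ hσ x ((hσ.monotone (le_max_left M₁ M₂)).trans hc)
    rw [eval₂_mul, hx, zero_mul] at h3
    exact lt_irrefl _ h3

theorem PolynomialIVP.exists_isRoot_of_odd_natDegree (hk : PolynomialIVP k) {f : k[X]}
    (hf : Odd f.natDegree) : ∃ x, f.IsRoot x := by
  have hf0 : f ≠ 0 := by rintro rfl; simp at hf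
  have hf' : f.comp (-X) ≠ 0 := fun h ↦ hf0 (by simpa [comp_assoc] using congrArg (comp · (-X)) h)
  obtain ⟨M₁, h₁⟩ := (monic_mul_leadingCoeff_inv hf0).exists_forall_eval₂_pos
  obtain ⟨M₂, h₂⟩ := (monic_mul_leadingCoeff_inv hf').exists_forall_eval₂_pos
  have hlc : (f.comp (-X)).leadingCoeff = -f.leadingCoeff := by
    rw [leadingCoeff_comp (by simp)]
    simp [hf.neg_one_pow]
  have hM : 0 < max 1 (max M₁ M₂) := lt_max_of_lt_left one_pos
  have hpos₁ := h₁ (RingHom.id k) strictMono_id (max 1 (max M₁ M₂)) (by simp)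
  have hpos₂ := h₂ (RingHom.id k) strictMono_id (max 1 (max M₁ M₂)) (by simp)
  rw [hlc] at hpos₂
  simp only [eval₂_id, eval_mul, eval_C, eval_comp, eval_neg, eval_X] at hpos₁ hpos₂
  obtain ⟨r, -, -, hr⟩ := hk f (-max 1 (max M₁ M₂)) (max 1 (max M₁ M₂)) (by linarith) (by
    have h3 := mul_pos hpos₁ hpos₂
    rw [inv_neg, mul_neg, mul_neg, neg_pos] at h3
    have h4 : 0 < f.leadingCoeff⁻¹ * f.leadingCoeff⁻¹ :=
      mul_self_pos.mpr (inv_ne_zero (leadingCoeff_ne_zero.mpr hf0))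
    by_contra! hc
    nlinarith [mul_nonneg hc h4.le])
  exact ⟨r, hr⟩

end Ordered

namespace PolynomialIVP

variable {k : Type*} [Field k] [LinearOrder k] [IsStrictOrderedRing k]

theorem sign_eval_eq_of_no_root (hk : PolynomialIVP k) {f : k[X]} {x y : k} (hxy : x ≤ y)
    (h : ∀ r, x ≤ r → r ≤ y → ¬ f.IsRoot r) : 0 < f.eval x * f.eval y := by
  rcases hxy.eq_or_lt with rfl | hlt
  · exact mul_self_pos.mpr (h x le_rfl le_rfl)
  · refine lt_of_le_of_ne ?_ (mul_ne_zero (h x le_rfl hxy) (h y hxy le_rfl)).symm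
    by_contra! hc
    obtain ⟨r, h1, h2, h3⟩ := hk f x y hlt hc
    exact h r h1.le h2.le h3

theorem exists_isRoot_derivative (hk : PolynomialIVP k) {f : k[X]} {x y : k} (hxy : x < y)
    (hx : f.IsRoot x) (hy : f.IsRoot y) :
    ∃ r, x ≤ r ∧ r ≤ y ∧ (derivative f).IsRoot r := by
  classical
  by_cases hf : f = 0
  · exact ⟨x, le_rfl, hxy.le, by simp [hf]⟩
  let s := f.roots.toFinset.filter fun r ↦ x < r ∧ r ≤ y
  have hs : s.Nonempty := ⟨y, by simp [s, hf, hy.eq_zero, hxy]⟩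
  set z := s.min' hs with hz
  have hzs : z ∈ s := s.min'_mem hs
  simp only [s, Finset.mem_filter, Multiset.mem_toFinset, mem_roots hf] at hzs
  obtain ⟨hz0, hxz, hzy⟩ := hzs
  obtain ⟨g, hg⟩ := dvd_iff_isRoot.mpr hx
  have hgz : g.IsRoot z := by
    have := hz0.eq_zero
    rw [hg, eval_mul, eval_sub, eval_X, eval_C, mul_eq_zero] at this
    exact this.resolve_left (sub_ne_zero.mpr hxz.ne')
  obtain ⟨h, hh⟩ := dvd_iff_isRoot.mpr hgz
  subst hh
  have hdx : (derivative f).eval x = (x - z) * h.eval x := by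
    rw [hg]; simp [derivative_mul]
  have hdz : (derivative f).eval z = (z - x) * h.eval z := by
    rw [hg]; simp [derivative_mul]
  by_contra! hc
  have hno : ∀ r, x ≤ r → r ≤ z → ¬ h.IsRoot r := by
    intro r hxr hrz hr
    rcases hxr.eq_or_lt with rfl | hxr
    · exact hc x le_rfl hxy.le (by rw [IsRoot, hdx, hr.eq_zero, mul_zero])
    rcases hrz.eq_or_lt with rfl | hrz
    · exact hc _ hxz.le hzy (by rw [IsRoot, hdz, hr.eq_zero, mul_zero])
    · refine hrz.not_ge (s.min'_le r ?_)
      simp only [s, Finset.mem_filter, Multiset.mem_toFinset, mem_roots hf]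
      exact ⟨by rw [IsRoot, hg, eval_mul, eval_mul, hr.eq_zero]; ring, hxr, hrz.le.trans hzy⟩
  have hpos := hk.sign_eval_eq_of_no_root hxz.le hno
  obtain ⟨r, h1, h2, h3⟩ := hk (derivative f) x z hxz (by
    rw [hdx, hdz]
    have : 0 < (z - x) * (z - x) := mul_self_pos.mpr (sub_ne_zero.mpr hxz.ne')
    nlinarith [mul_pos hpos this])
  exact hc r h1.le (h2.le.trans hzy) h3

/-- A polynomial changes sign at a root isolated from the critical points. -/
theorem eval_mul_eval_neg (hk : PolynomialIVP k) {f : k[X]} {x θ y : k} (hxθ : x < θ) (hθy : θ < y)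
    (hθ : f.IsRoot θ) (hx : ¬ f.IsRoot x) (hy : ¬ f.IsRoot y)
    (hd : ∀ r, x < r → r < y → ¬ (derivative f).IsRoot r) : f.eval x * f.eval y < 0 := by
  obtain ⟨g, rfl⟩ := dvd_iff_isRoot.mpr hθ
  have hpos := hk.sign_eval_eq_of_no_root (f := g) (hxθ.trans hθy).le (by
    intro r hxr hry hr
    have hr' : ((X - C θ) * g).IsRoot r := by rw [IsRoot, eval_mul, hr.eq_zero, mul_zero]
    have hxr : x < r := lt_of_le_of_ne hxr (by rintro rfl; exact hx hr')
    have hry : r < y := lt_of_le_of_ne hry (by rintro rfl; exact hy hr')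
    rcases lt_trichotomy r θ with h | rfl | h
    · obtain ⟨c, h1, h2, h3⟩ := hk.exists_isRoot_derivative h hr' hθ
      exact hd c (hxr.trans_le h1) (h2.trans_lt hθy) h3
    · exact hd r hxr hry (by simp [derivative_mul, hr.eq_zero])
    · obtain ⟨c, h1, h2, h3⟩ := hk.exists_isRoot_derivative h hθ hr'
      exact hd c (hxθ.trans_le h1) (h2.trans_lt hry) h3)
  simp only [eval_mul, eval_sub, eval_X, eval_C]
  nlinarith [mul_pos (mul_pos (sub_pos.mpr hxθ) (sub_pos.mpr hθy)) hpos]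

end PolynomialIVP

theorem sign_map_of_strictMono {k F : Type*} [Field k] [LinearOrder k] [Field F] [LinearOrder F]
    {σ : k →+* F} (hσ : StrictMono σ) (t : k) : SignType.sign (σ t) = SignType.sign t := by
  rcases lt_trichotomy t 0 with h | rfl | h
  · rw [sign_neg h, sign_neg (by simpa using hσ h)]
  · simp
  · rw [sign_pos h, sign_pos (by simpa using hσ h)]

theorem PolynomialIVP.sign_eval₂_eq_sign_eval_zero {k F : Type*} [Field k] [LinearOrder k]
    [Field F] [LinearOrder F] [IsStrictOrderedRing F] {σ : k →+* F} (hF : PolynomialIVP F)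
    (hσ : StrictMono σ) {g : k[X]} (hg : ∀ x, g.eval₂ σ x ≠ 0) (x : F) :
    SignType.sign (g.eval₂ σ x) = SignType.sign (g.eval 0) := by
  have hno : ∀ x y, x ≤ y → 0 < g.eval₂ σ x * g.eval₂ σ y := by
    intro x y hxy
    have := hF.sign_eval_eq_of_no_root (f := g.map σ) hxy
      (fun r _ _ hr ↦ hg r (by rwa [IsRoot, eval_map] at hr))
    rwa [eval_map, eval_map] at this
  have hpos : 0 < g.eval₂ σ x * g.eval₂ σ 0 := by
    rcases le_total x 0 with h | h
    · exact hno x 0 h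
    · rw [mul_comm]; exact hno 0 x h
  have h1 : g.eval₂ σ 0 = σ (g.eval 0) := by rw [← map_zero σ, eval₂_at_apply]
  rw [← sign_map_of_strictMono hσ, ← h1]
  rcases pos_and_pos_or_neg_and_neg_of_mul_pos hpos with ⟨h2, h3⟩ | ⟨h2, h3⟩
  · rw [sign_pos h2, sign_pos h3]
  · rw [sign_neg h2, sign_neg h3]

section Extension

variable {k F₁ F₂ : Type*} [Field k] [LinearOrder k] [IsStrictOrderedRing k]
  [Field F₁] [LinearOrder F₁] [IsStrictOrderedRing F₁]
  [Field F₂] [LinearOrder F₂] [IsStrictOrderedRing F₂]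
  {σ₁ : k →+* F₁} {σ₂ : k →+* F₂}

theorem Polynomial.natDegree_derivative_lt_of_char_zero {f : k[X]} (hf : f.natDegree ≠ 0) :
    derivative f ≠ 0 ∧ (derivative f).natDegree < f.natDegree :=
  ⟨fun h ↦ hf (derivative_eq_zero.mp h), natDegree_derivative_lt hf⟩

/-- If `θ` is a root of `f` in `F₁` and all polynomials of smaller degree have all their roots
from `F₁` and `F₂` already in `k`, then `f` has a root in `F₂` realizing the same cut over `k`. -/
theorem exists_root_same_cut (h₁ : StrictMono σ₁) (h₂ : StrictMono σ₂)
    (hF₁ : PolynomialIVP F₁) (hF₂ : PolynomialIVP F₂) {f : k[X]} {θ : F₁}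
    (hf : f ≠ 0) (hθ : f.eval₂ σ₁ θ = 0) (hθk : θ ∉ Set.range σ₁)
    (hroots₁ : ∀ g : k[X], g ≠ 0 → g.natDegree < f.natDegree → ∀ x, g.eval₂ σ₁ x = 0 →
      x ∈ Set.range σ₁)
    (hroots₂ : ∀ g : k[X], g ≠ 0 → g.natDegree < f.natDegree → ∀ x, g.eval₂ σ₂ x = 0 →
      x ∈ Set.range σ₂) :
    ∃ θ' : F₂, f.eval₂ σ₂ θ' = 0 ∧ ∀ t, σ₁ t < θ ↔ σ₂ t < θ' := by
  classical
  have hdeg : f.natDegree ≠ 0 := by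
    intro h
    rw [eq_C_of_natDegree_eq_zero h, eval₂_C, map_eq_zero] at hθ
    rw [eq_C_of_natDegree_eq_zero h, hθ, C_0] at hf
    exact hf rfl
  have hnoroot : ∀ t, ¬ f.IsRoot t := by
    intro t ht
    obtain ⟨g, hg⟩ := dvd_iff_isRoot.mpr ht
    have hg0 : g ≠ 0 := by rintro rfl; simp [hf] at hg
    refine hθk (hroots₁ g hg0 ?_ θ ?_)
    · rw [hg, natDegree_mul (X_sub_C_ne_zero t) hg0, natDegree_X_sub_C]
      omega
    · rw [hg, eval₂_mul, eval₂_sub, eval₂_X, eval₂_C, mul_eq_zero] at hθ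
      exact hθ.resolve_left fun h ↦ hθk ⟨t, (sub_eq_zero.mp h).symm⟩
  obtain ⟨hd0, hdlt⟩ := natDegree_derivative_lt_of_char_zero hdeg
  obtain ⟨M, hM⟩ := exists_forall_root_mem_Ioo.{_, _} hf
  obtain ⟨hM₁, hM₂⟩ := hM σ₁ h₁ θ hθ
  let Z := (derivative f).roots.toFinset
  let A := insert (-M) (Z.filter fun z ↦ σ₁ z < θ)
  let B := insert M (Z.filter fun z ↦ θ < σ₁ z)
  have hA : A.Nonempty := Finset.insert_nonempty _ _
  have hB : B.Nonempty := Finset.insert_nonempty _ _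
  set a := A.max' hA
  set b := B.min' hB
  have haθ : σ₁ a < θ := by
    have := A.max'_mem hA
    rcases Finset.mem_insert.mp this with h | h
    · change σ₁ (A.max' hA) < θ
      rwa [h]
    · exact (Finset.mem_filter.mp h).2
  have hθb : θ < σ₁ b := by
    have := B.min'_mem hB
    rcases Finset.mem_insert.mp this with h | h
    · change θ < σ₁ (B.min' hB)
      rwa [h]
    · exact (Finset.mem_filter.mp h).2
  have hab : a < b := h₁.lt_iff_lt.mp (haθ.trans hθb)
  have hZ : ∀ z, (derivative f).IsRoot z → z ≤ a ∨ b ≤ z := by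
    intro z hz
    have hzZ : z ∈ Z := by simpa [Z, hd0] using hz
    rcases lt_or_gt_of_ne (fun h ↦ hθk ⟨z, h⟩ : σ₁ z ≠ θ) with h | h
    · exact .inl (A.le_max' z (Finset.mem_insert_of_mem (Finset.mem_filter.mpr ⟨hzZ, h⟩)))
    · exact .inr (B.min'_le z (Finset.mem_insert_of_mem (Finset.mem_filter.mpr ⟨hzZ, h⟩)))
  have hcrit₁ : ∀ r, σ₁ a < r → r < σ₁ b → ¬ (derivative (f.map σ₁)).IsRoot r := by
    intro r har hrb hr
    rw [derivative_map, IsRoot, eval_map] at hr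
    obtain ⟨z, rfl⟩ := hroots₁ _ hd0 hdlt r hr
    rw [eval₂_at_apply, map_eq_zero] at hr
    rcases hZ z hr with h | h
    · exact (h₁.lt_iff_lt.mp har).not_ge h
    · exact (h₁.lt_iff_lt.mp hrb).not_ge h
  have hcrit₂ : ∀ r, σ₂ a < r → r < σ₂ b → ¬ (derivative (f.map σ₂)).IsRoot r := by
    intro r har hrb hr
    rw [derivative_map, IsRoot, eval_map] at hr
    obtain ⟨z, rfl⟩ := hroots₂ _ hd0 hdlt r hr
    rw [eval₂_at_apply, map_eq_zero] at hr
    rcases hZ z hr with h | h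
    · exact (h₂.lt_iff_lt.mp har).not_ge h
    · exact (h₂.lt_iff_lt.mp hrb).not_ge h
  have hne₁ : ∀ t, ¬ (f.map σ₁).IsRoot (σ₁ t) := by
    intro t ht
    rw [IsRoot, eval_map, eval₂_at_apply, map_eq_zero] at ht
    exact hnoroot t ht
  have hne₂ : ∀ t, ¬ (f.map σ₂).IsRoot (σ₂ t) := by
    intro t ht
    rw [IsRoot, eval_map, eval₂_at_apply, map_eq_zero] at ht
    exact hnoroot t ht
  have neg₁ : ∀ s t, a ≤ s → t ≤ b → σ₁ s < θ → θ < σ₁ t → f.eval s * f.eval t < 0 := by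
    intro s t has htb hs ht
    have := hF₁.eval_mul_eval_neg hs ht (f := f.map σ₁) (by rwa [IsRoot, eval_map]) (hne₁ s)
      (hne₁ t) fun r hr1 hr2 ↦ hcrit₁ r ((h₁.monotone has).trans_lt hr1)
        (hr2.trans_le (h₁.monotone htb))
    rw [eval_map, eval_map, eval₂_at_apply, eval₂_at_apply, ← map_mul, ← map_zero σ₁] at this
    exact h₁.lt_iff_lt.mp this
  have hfab := neg₁ a b le_rfl le_rfl haθ hθb
  obtain ⟨θ', haθ', hθ'b, hθ'⟩ := hF₂ (f.map σ₂) (σ₂ a) (σ₂ b) (h₂ hab) (by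
    rw [eval_map, eval_map, eval₂_at_apply, eval₂_at_apply, ← map_mul, ← map_zero σ₂]
    exact h₂ hfab)
  have neg₂ : ∀ s t, a ≤ s → t ≤ b → σ₂ s < θ' → θ' < σ₂ t → f.eval s * f.eval t < 0 := by
    intro s t has htb hs ht
    have := hF₂.eval_mul_eval_neg hs ht (f := f.map σ₂) hθ' (hne₂ s)
      (hne₂ t) fun r hr1 hr2 ↦ hcrit₂ r ((h₂.monotone has).trans_lt hr1)
        (hr2.trans_le (h₂.monotone htb))
    rw [eval_map, eval_map, eval₂_at_apply, eval₂_at_apply, ← map_mul, ← map_zero σ₂] at this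
    exact h₂.lt_iff_lt.mp this
  have hθ0 : f.eval₂ σ₂ θ' = 0 := by rwa [IsRoot, eval_map] at hθ'
  refine ⟨θ', hθ0, fun t ↦ ?_⟩
  rcases le_or_gt t a with hta | hat
  · exact ⟨fun _ ↦ (h₂.monotone hta).trans_lt haθ', fun _ ↦ (h₁.monotone hta).trans_lt haθ⟩
  rcases le_or_gt b t with hbt | htb
  · exact ⟨fun h ↦ (h.not_ge (hθb.le.trans (h₁.monotone hbt))).elim,
      fun h ↦ (h.not_ge (hθ'b.le.trans (h₂.monotone hbt))).elim⟩
  have contra : f.eval a * f.eval t < 0 → f.eval t * f.eval b < 0 → False := by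
    intro h3 h4
    nlinarith [mul_pos_of_neg_of_neg h3 h4, mul_self_nonneg (f.eval t)]
  constructor
  · intro h
    by_contra! hc
    refine contra (neg₂ a t le_rfl htb.le haθ' (lt_of_le_of_ne hc ?_))
      (neg₁ t b hat.le le_rfl h hθb)
    rintro rfl
    exact hne₂ t hθ'
  · intro h
    by_contra! hc
    refine contra (neg₁ a t le_rfl htb.le haθ (lt_of_le_of_ne hc ?_))
      (neg₂ t b hat.le le_rfl h hθ'b)
    exact fun h ↦ hθk ⟨t, h.symm⟩

theorem sign_eval₂_eq (h₁ : StrictMono σ₁) (h₂ : StrictMono σ₂)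
    (hF₁ : PolynomialIVP F₁) (hF₂ : PolynomialIVP F₂) {f : k[X]} {θ : F₁} {θ' : F₂}
    (hf : f.natDegree ≠ 0) (hθ : f.eval₂ σ₁ θ = 0) (hθ' : f.eval₂ σ₂ θ' = 0)
    (hθk : θ ∉ Set.range σ₁)
    (hroots₁ : ∀ g : k[X], g ≠ 0 → g.natDegree < f.natDegree → ∀ x, g.eval₂ σ₁ x = 0 →
      x ∈ Set.range σ₁)
    (hroots₂ : ∀ g : k[X], g ≠ 0 → g.natDegree < f.natDegree → ∀ x, g.eval₂ σ₂ x = 0 →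
      x ∈ Set.range σ₂)
    (hcut : ∀ t, σ₁ t < θ ↔ σ₂ t < θ') (g : k[X]) :
    SignType.sign (g.eval₂ σ₁ θ) = SignType.sign (g.eval₂ σ₂ θ') := by
  have hθ'k : θ' ∉ Set.range σ₂ := by
    rintro ⟨t, rfl⟩
    rw [eval₂_at_apply, map_eq_zero] at hθ'
    obtain ⟨g, hg⟩ := dvd_iff_isRoot.mpr hθ'
    have hf0 : f ≠ 0 := by rintro rfl; simp at hf
    have hg0 : g ≠ 0 := by rintro rfl; simp [hf0] at hg
    refine hθk (hroots₁ g hg0 ?_ θ ?_)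
    · rw [hg, natDegree_mul (X_sub_C_ne_zero t) hg0, natDegree_X_sub_C]
      omega
    · rw [hg, eval₂_mul, eval₂_sub, eval₂_X, eval₂_C, mul_eq_zero] at hθ
      exact hθ.resolve_left fun h ↦ hθk ⟨t, (sub_eq_zero.mp h).symm⟩
  have small : ∀ n, ∀ g : k[X], g.natDegree = n → n < f.natDegree →
      SignType.sign (g.eval₂ σ₁ θ) = SignType.sign (g.eval₂ σ₂ θ') := by
    intro n
    induction n using Nat.strong_induction_on with
    | _ n ih =>
    intro g hg hlt
    by_cases hg0 : g = 0
    · simp [hg0]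
    by_cases hr : ∃ t, g.IsRoot t
    · obtain ⟨t, ht⟩ := hr
      obtain ⟨h, rfl⟩ := dvd_iff_isRoot.mpr ht
      have hh0 : h ≠ 0 := by rintro rfl; simp at hg0
      rw [natDegree_mul (X_sub_C_ne_zero t) hh0, natDegree_X_sub_C] at hg
      rw [eval₂_mul, eval₂_mul, sign_mul, sign_mul, ih h.natDegree (by omega) h rfl (by omega)]
      congr 1
      rw [eval₂_sub, eval₂_sub, eval₂_X, eval₂_X, eval₂_C, eval₂_C]
      rcases lt_or_gt_of_ne (fun h ↦ hθk ⟨t, h⟩ : σ₁ t ≠ θ) with h | h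
      · rw [sign_pos (sub_pos.mpr h), sign_pos (sub_pos.mpr ((hcut t).mp h))]
      · rw [sign_neg (sub_neg.mpr h), sign_neg (sub_neg.mpr ?_)]
        refine lt_of_le_of_ne ?_ fun h ↦ hθ'k ⟨t, h.symm⟩
        by_contra! hc
        exact ((hcut t).mpr hc).not_gt h
    · rw [not_exists] at hr
      rw [hF₁.sign_eval₂_eq_sign_eval_zero h₁, hF₂.sign_eval₂_eq_sign_eval_zero h₂]
      · intro x hx
        obtain ⟨t, rfl⟩ := hroots₂ g hg0 (by omega) x hx
        rw [eval₂_at_apply, map_eq_zero] at hx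
        exact hr t hx
      · intro x hx
        obtain ⟨t, rfl⟩ := hroots₁ g hg0 (by omega) x hx
        rw [eval₂_at_apply, map_eq_zero] at hx
        exact hr t hx
  have h3 := small _ (g % f) rfl (natDegree_mod_lt g hf)
  rwa [EuclideanDomain.mod_eq_sub_mul_div, eval₂_sub, eval₂_sub, eval₂_mul, eval₂_mul, hθ, hθ',
    zero_mul, zero_mul, sub_zero, sub_zero] at h3

end Extension

theorem exists_sign_eval₂_eq {k F₁ F₂ : Type*} [Field k] [LinearOrder k] [IsStrictOrderedRing k]
    [Field F₁] [LinearOrder F₁] [IsStrictOrderedRing F₁]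
    [Field F₂] [LinearOrder F₂] [IsStrictOrderedRing F₂] {σ₁ : k →+* F₁} {σ₂ : k →+* F₂}
    (h₁ : StrictMono σ₁) (h₂ : StrictMono σ₂) (hF₁ : PolynomialIVP F₁) (hF₂ : PolynomialIVP F₂)
    {f : k[X]} {θ : F₁} (hf : f ≠ 0) (hθ : f.eval₂ σ₁ θ = 0) (hθk : θ ∉ Set.range σ₁) :
    ∃ x : F₁ × F₂, (x.1 ∉ Set.range σ₁ ∨ x.2 ∉ Set.range σ₂) ∧
      ∀ g : k[X], SignType.sign (g.eval₂ σ₁ x.1) = SignType.sign (g.eval₂ σ₂ x.2) := by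
  classical
  let p : ℕ → Prop := fun n ↦ ∃ f : k[X], f ≠ 0 ∧ f.natDegree = n ∧
    ((∃ x, f.eval₂ σ₁ x = 0 ∧ x ∉ Set.range σ₁) ∨ ∃ x, f.eval₂ σ₂ x = 0 ∧ x ∉ Set.range σ₂)
  have hp : ∃ n, p n := ⟨_, f, hf, rfl, .inl ⟨θ, hθ, hθk⟩⟩
  obtain ⟨f, hf, hn, hroot⟩ := Nat.find_spec hp
  have hmin₁ : ∀ g : k[X], g ≠ 0 → g.natDegree < f.natDegree → ∀ x, g.eval₂ σ₁ x = 0 →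
      x ∈ Set.range σ₁ := by
    intro g hg hlt x hx
    by_contra hc
    exact Nat.find_min hp (hn ▸ hlt) ⟨g, hg, rfl, .inl ⟨x, hx, hc⟩⟩
  have hmin₂ : ∀ g : k[X], g ≠ 0 → g.natDegree < f.natDegree → ∀ x, g.eval₂ σ₂ x = 0 →
      x ∈ Set.range σ₂ := by
    intro g hg hlt x hx
    by_contra hc
    exact Nat.find_min hp (hn ▸ hlt) ⟨g, hg, rfl, .inr ⟨x, hx, hc⟩⟩
  have hdeg : f.natDegree ≠ 0 := by
    intro h
    rw [eq_C_of_natDegree_eq_zero h] at hroot hf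
    simp only [eval₂_C, map_eq_zero, ne_eq] at hroot hf
    tauto
  rcases hroot with ⟨x, hx, hxk⟩ | ⟨y, hy, hyk⟩
  · obtain ⟨y, hy, hcut⟩ := exists_root_same_cut h₁ h₂ hF₁ hF₂ hf hx hxk hmin₁ hmin₂
    exact ⟨(x, y), .inl hxk, sign_eval₂_eq h₁ h₂ hF₁ hF₂ hdeg hx hy hxk hmin₁ hmin₂ hcut⟩
  · obtain ⟨x, hx, hcut⟩ := exists_root_same_cut h₂ h₁ hF₂ hF₁ hf hy hyk hmin₂ hmin₁
    exact ⟨(x, y), .inr hyk,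
      fun g ↦ (sign_eval₂_eq h₂ h₁ hF₂ hF₁ hdeg hy hx hyk hmin₂ hmin₁ hcut g).symm⟩

theorem exists_sign_eval₂_eq_of_sign_eq {k F₁ F₂ : Type*} [Field k]
    [Field F₁] [LinearOrder F₁] [IsStrictOrderedRing F₁]
    [Field F₂] [LinearOrder F₂] [IsStrictOrderedRing F₂] {σ₁ : k →+* F₁} {σ₂ : k →+* F₂}
    (hsign : ∀ t, SignType.sign (σ₁ t) = SignType.sign (σ₂ t)) (hF₁ : PolynomialIVP F₁)
    (hF₂ : PolynomialIVP F₂) {f : k[X]} {θ : F₁} (hf : f ≠ 0) (hθ : f.eval₂ σ₁ θ = 0)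
    (hθk : θ ∉ Set.range σ₁) :
    ∃ x : F₁ × F₂, (x.1 ∉ Set.range σ₁ ∨ x.2 ∉ Set.range σ₂) ∧
      ∀ g : k[X], SignType.sign (g.eval₂ σ₁ x.1) = SignType.sign (g.eval₂ σ₂ x.2) := by
  let : LinearOrder k := LinearOrder.lift' σ₁ σ₁.injective
  have hlt : ∀ {x y}, σ₁ x < σ₁ y ↔ x < y := Iff.rfl
  have : IsStrictOrderedRing k :=
    Function.Injective.isStrictOrderedRing σ₁ (map_zero _) (map_one _) (map_add _) (map_mul _)
      Iff.rfl hlt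
  refine exists_sign_eval₂_eq (fun _ _ ↦ hlt.mpr) (fun x y hxy ↦ ?_) hF₁ hF₂ hf hθ hθk
  have h := hsign (y - x)
  rw [map_sub σ₁, map_sub σ₂, sign_pos (sub_pos.mpr (hlt.mpr hxy)), eq_comm, sign_eq_one_iff] at h
  exact sub_pos.mp h

section

variable {k₀ F₁ F₂ : Type*} [Field k₀] [Field F₁] [LinearOrder F₁]
  [Field F₂] [LinearOrder F₂] {j₁ : k₀ →+* F₁} {j₂ : k₀ →+* F₂}

theorem Subring.isField_of_sign_eq (hj : j₁.IsIntegral) {S : Subring (F₁ × F₂)}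
    (hS : ∀ a, (j₁ a, j₂ a) ∈ S) (hsign : ∀ x ∈ S, SignType.sign x.1 = SignType.sign x.2) :
    IsField S := by
  have hinj : ∀ x ∈ S, x.1 = 0 → x = 0 := by
    intro x hx h
    have := hsign x hx
    rw [h, sign_zero, eq_comm, sign_eq_zero_iff] at this
    exact Prod.ext h this
  have hfst : Function.Injective ((RingHom.fst F₁ F₂).comp S.subtype) := by
    rw [injective_iff_map_eq_zero]
    intro x hx
    exact Subtype.ext (hinj x x.2 hx)
  have : IsDomain S := hfst.isDomain
  let i : k₀ →+* S := (j₁.prod j₂).codRestrict S hS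
  refine (MulEquiv.isField · (MulEquiv.refl _)) ?_
  let := i.toAlgebra
  have : Algebra.IsIntegral k₀ S := by
    refine ⟨fun x ↦ ?_⟩
    obtain ⟨p, hp, hx⟩ := hj x.1.1
    refine ⟨p, hp, hfst ?_⟩
    rw [map_zero, hom_eval₂]
    exact hx
  exact isField_of_isIntegral_of_isField' (Field.toIsField k₀)

theorem exists_ringHom_of_sign_eq [IsStrictOrderedRing F₁] [IsStrictOrderedRing F₂]
    (hj : j₁.IsIntegral) (hF₁ : PolynomialIVP F₁)
    (hF₂ : PolynomialIVP F₂) (hsign : ∀ a, SignType.sign (j₁ a) = SignType.sign (j₂ a)) :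
    ∃ φ : F₁ →+* F₂, φ.comp j₁ = j₂ := by
  classical
  let good : Set (Subring (F₁ × F₂)) :=
    {S | (∀ a, (j₁ a, j₂ a) ∈ S) ∧ ∀ x ∈ S, SignType.sign x.1 = SignType.sign x.2}
  obtain ⟨S, -, hS⟩ := zorn_le_nonempty₀ good (by
    intro c hc hchain S hSc
    refine ⟨sSup c, ⟨fun a ↦ le_sSup hSc ((hc hSc).1 a), fun x hx ↦ ?_⟩, fun T hT ↦ le_sSup hT⟩
    obtain ⟨T, hT, hxT⟩ := (Subring.mem_sSup_of_directedOn ⟨S, hSc⟩ hchain.directedOn).mp hx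
    exact (hc hT).2 x hxT) (j₁.prod j₂).range ⟨fun a ↦ ⟨a, rfl⟩, by
      rintro _ ⟨a, rfl⟩
      exact hsign a⟩
  have hfield := Subring.isField_of_sign_eq hj hS.prop.1 hS.prop.2
  let : Field S := hfield.toField
  let σ₁ : S →+* F₁ := (RingHom.fst F₁ F₂).comp S.subtype
  let σ₂ : S →+* F₂ := (RingHom.snd F₁ F₂).comp S.subtype
  have hsurj : Function.Surjective σ₁ := by
    intro θ
    by_contra hθ
    obtain ⟨p, hp, hpθ⟩ := hj θ
    let i : k₀ →+* S := (j₁.prod j₂).codRestrict S hS.prop.1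
    obtain ⟨x, hx, hxs⟩ := exists_sign_eval₂_eq_of_sign_eq
      (σ₁ := σ₁) (σ₂ := σ₂) (fun t ↦ hS.prop.2 _ t.2) hF₁ hF₂ (hp.map i).ne_zero
      (θ := θ) (by rw [eval₂_map]; exact hpθ) hθ
    let ψ : S[X] →+* F₁ × F₂ := (eval₂RingHom σ₁ x.1).prod (eval₂RingHom σ₂ x.2)
    have hψ : ∀ s : S, ψ (C s) = s := fun s ↦ by simp [ψ, σ₁, σ₂]
    have hle : S ≤ ψ.range := fun s hs ↦ ⟨C ⟨s, hs⟩, hψ _⟩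
    have hmem : x ∈ S := hS.le_of_ge ⟨fun a ↦ hle (hS.prop.1 a), by
      rintro _ ⟨g, rfl⟩
      exact hxs g⟩ hle ⟨X, by simp [ψ]⟩
    rcases hx with h | h
    · exact h ⟨⟨x, hmem⟩, rfl⟩
    · exact h ⟨⟨x, hmem⟩, rfl⟩
  let e := RingEquiv.ofBijective σ₁ ⟨σ₁.injective, hsurj⟩
  refine ⟨σ₂.comp e.symm, RingHom.ext fun a ↦ ?_⟩
  have : e.symm (j₁ a) = ⟨(j₁ a, j₂ a), hS.prop.1 a⟩ := by
    rw [RingEquiv.symm_apply_eq]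
    rfl
  change σ₂ (e.symm (j₁ a)) = _
  rw [this]
  rfl

end

/-- Uniqueness of real closures: real closed algebraic extensions inducing the same ordering
are isomorphic. -/
theorem IsRealClosed.exists_ringHom_comp_eq {k₀ F₁ F₂ : Type*} [Field k₀] [Field F₁] [Field F₂]
    [IsRealClosed F₁] [IsRealClosed F₂] {j₁ : k₀ →+* F₁} {j₂ : k₀ →+* F₂} (hj : j₁.IsIntegral)
    (h : ∀ a, IsSquare (j₁ a) ↔ IsSquare (j₂ a)) : ∃ φ : F₁ →+* F₂, φ.comp j₁ = j₂ := by
  obtain ⟨_, _⟩ := IsRealClosed.exists_linearOrder F₁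
  obtain ⟨_, _⟩ := IsRealClosed.exists_linearOrder F₂
  refine exists_ringHom_of_sign_eq hj IsRealClosed.polynomialIVP IsRealClosed.polynomialIVP
    fun a ↦ ?_
  have key : ∀ a, 0 ≤ j₁ a ↔ 0 ≤ j₂ a := fun a ↦ by
    rw [IsRealClosed.nonneg_iff_isSquare, IsRealClosed.nonneg_iff_isSquare, h]
  have key' := key (-a)
  rw [map_neg, map_neg, neg_nonneg, neg_nonneg] at key'
  rcases lt_trichotomy (j₁ a) 0 with h | h | h
  · rw [sign_neg h, sign_neg (by rw [← not_le] at h ⊢; rwa [← key])]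
  · rw [map_eq_zero] at h
    simp [h]
  · rw [sign_pos h, sign_pos (by rw [← not_le] at h ⊢; rwa [← key'])]

/-- The cone spanned by the products of elements of `P` with squares of elements of `K`. -/
def squareCone {Ω : Type*} [CommRing Ω] (P K : Set Ω) : AddSubmonoid Ω :=
  AddSubmonoid.closure {y | ∃ p ∈ P, ∃ x ∈ K, y = p * x ^ 2}

section

variable {Ω : Type*} [Field Ω] {P : Set Ω}

theorem squareCone_mono {K L : Set Ω} (h : K ⊆ L) : squareCone P K ≤ squareCone P L :=
  AddSubmonoid.closure_mono fun _ ⟨p, hp, x, hx, hy⟩ ↦ ⟨p, hp, x, h hx, hy⟩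

theorem mul_mem_squareCone (hmul : ∀ a ∈ P, ∀ b ∈ P, a * b ∈ P) {S : Subfield Ω} {x y : Ω}
    (hx : x ∈ squareCone P S) (hy : y ∈ squareCone P S) : x * y ∈ squareCone P S := by
  induction hx using AddSubmonoid.closure_induction with
  | zero => rw [zero_mul]; exact zero_mem _
  | add a b _ _ ha hb => rw [add_mul]; exact add_mem ha hb
  | mem a ha =>
    induction hy using AddSubmonoid.closure_induction with
    | zero => rw [mul_zero]; exact zero_mem _
    | add b c _ _ hb hc => rw [mul_add]; exact add_mem hb hc
    | mem b hb =>
      obtain ⟨p, hp, u, hu, rfl⟩ := ha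
      obtain ⟨q, hq, v, hv, rfl⟩ := hb
      exact AddSubmonoid.subset_closure
        ⟨p * q, hmul p hp q hq, u * v, S.mul_mem hu hv, by ring⟩

theorem exists_mem_squareCone_of_adjoin_sqrt {S : Subfield Ω} (hP : P ⊆ S) {a s : Ω} (ha : a ∈ S)
    (hs : s ^ 2 = a) {x : Ω} (hx : x ∈ squareCone P (eval₂RingHom S.subtype s).range) :
    ∃ t ∈ squareCone P (S : Set Ω), ∃ t' ∈ squareCone P (S : Set Ω), ∃ z ∈ S,
      x = t + a * t' + z * s := by
  induction hx using AddSubmonoid.closure_induction with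
  | zero => exact ⟨0, zero_mem _, 0, zero_mem _, 0, zero_mem _, by simp⟩
  | add x y _ _ hx hy =>
    obtain ⟨t, ht, t', ht', z, hz, rfl⟩ := hx
    obtain ⟨u, hu, u', hu', w, hw, rfl⟩ := hy
    exact ⟨t + u, add_mem ht hu, t' + u', add_mem ht' hu', z + w, add_mem hz hw, by ring⟩
  | mem x hx =>
    obtain ⟨p, hp, _, ⟨g, rfl⟩, rfl⟩ := hx
    have hmonic : (X ^ 2 - C (⟨a, ha⟩ : S)).Monic := monic_X_pow_sub_C _ two_ne_zero
    have hdeg : (g %ₘ (X ^ 2 - C (⟨a, ha⟩ : S))).natDegree ≤ 1 := by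
      have := natDegree_modByMonic_lt g hmonic fun h ↦ by simpa using congrArg natDegree h
      rw [natDegree_X_pow_sub_C] at this
      omega
    obtain ⟨y, x, h⟩ := exists_eq_X_add_C_of_natDegree_le_one hdeg
    have hg : eval₂RingHom S.subtype s g = y * s + x := by
      rw [← modByMonic_add_div g (X ^ 2 - C (⟨a, ha⟩ : S)), h]
      simp [hs]
    rw [hg]
    exact ⟨p * x ^ 2, AddSubmonoid.subset_closure ⟨p, hp, x, x.2, rfl⟩,
      p * y ^ 2, AddSubmonoid.subset_closure ⟨p, hp, y, y.2, rfl⟩,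
      2 * p * x * y, S.mul_mem (S.mul_mem (S.mul_mem (ofNat_mem S 2) (hP hp)) x.2) y.2,
      by rw [← hs]; ring⟩

theorem exists_isRealClosed_subfield [IsAlgClosed Ω] (hmul : ∀ a ∈ P, ∀ b ∈ P, a * b ∈ P)
    (hone : 1 ∈ P) {k₀ : Subfield Ω} (hP : P ⊆ k₀) (halg : ∀ x : Ω, IsIntegral k₀ x)
    (h : -1 ∉ squareCone P k₀) :
    ∃ S : Subfield Ω, k₀ ≤ S ∧ IsRealClosed S ∧ ∀ p ∈ P, ∃ s ∈ S, s ^ 2 = p := by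
  classical
  obtain ⟨S, hkS, hS⟩ := zorn_le_nonempty₀ {S : Subfield Ω | -1 ∉ squareCone P S} (by
    intro c hc hchain S hSc
    refine ⟨sSup c, fun hmem ↦ ?_, fun T hT ↦ le_sSup hT⟩
    have key : ∀ x ∈ squareCone P (sSup c : Subfield Ω), ∃ T ∈ c, x ∈ squareCone P T := by
      intro x hx
      induction hx using AddSubmonoid.closure_induction with
      | zero => exact ⟨S, hSc, zero_mem _⟩
      | add x y _ _ hx hy =>
        obtain ⟨T, hT, hxT⟩ := hx
        obtain ⟨U, hU, hyU⟩ := hy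
        obtain ⟨V, hV, hTV, hUV⟩ := hchain.directedOn T hT U hU
        exact ⟨V, hV, add_mem (squareCone_mono hTV hxT) (squareCone_mono hUV hyU)⟩
      | mem x hx =>
        obtain ⟨p, hp, y, hy, rfl⟩ := hx
        obtain ⟨T, hT, hyT⟩ := (Subfield.mem_sSup_of_directedOn ⟨S, hSc⟩ hchain.directedOn).mp hy
        exact ⟨T, hT, AddSubmonoid.subset_closure ⟨p, hp, y, hyT, rfl⟩⟩
    obtain ⟨T, hT, h⟩ := key _ hmem
    exact hc hT h) k₀ h
  have hPS : P ⊆ S := hP.trans hkS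
  have hSneg : -1 ∉ squareCone P S := hS.prop
  have hint : ∀ x : Ω, IsIntegral S x := fun x ↦ by
    obtain ⟨p, hp, hx⟩ := halg x
    exact ⟨p.map (Subfield.inclusion hkS), hp.map _, by rw [eval₂_map]; exact hx⟩
  have ext : ∀ θ : Ω, θ ∉ S → -1 ∈ squareCone P (eval₂RingHom S.subtype θ).range := by
    intro θ hθ
    by_contra hc
    have hirr := minpoly.irreducible (hint θ)
    have : Fact (Irreducible (minpoly S θ)) := ⟨hirr⟩
    let φ : AdjoinRoot (minpoly S θ) →+* Ω := AdjoinRoot.lift S.subtype θ (minpoly.aeval S θ)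
    have hφ : ∀ g : S[X], φ (AdjoinRoot.mk _ g) = eval₂RingHom S.subtype θ g := fun g ↦
      AdjoinRoot.lift_mk _ _
    have hle : S ≤ φ.fieldRange := fun x hx ↦
      ⟨AdjoinRoot.mk _ (C ⟨x, hx⟩), by rw [hφ]; simp⟩
    refine hθ (hS.le_of_ge (fun hmem ↦ hc (squareCone_mono ?_ hmem)) hle
      ⟨AdjoinRoot.mk _ X, by rw [hφ]; simp⟩)
    rintro _ ⟨y, rfl⟩
    obtain ⟨g, rfl⟩ := AdjoinRoot.mk_surjective y
    exact ⟨g, (hφ g).symm⟩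
  have sqrt : ∀ {a s : Ω}, a ∈ S → s ^ 2 = a → s ∉ S → ∃ t ∈ squareCone P (S : Set Ω),
      ∃ t' ∈ squareCone P (S : Set Ω), -1 = t + a * t' := by
    intro a s ha hs hsS
    obtain ⟨t, ht, t', ht', z, hz, heq⟩ := exists_mem_squareCone_of_adjoin_sqrt hPS ha hs (ext s hsS)
    have hcone : ∀ x ∈ squareCone P (S : Set Ω), x ∈ S := by
      have : squareCone P S ≤ S.toSubring.toAddSubgroup.toAddSubmonoid :=
        AddSubmonoid.closure_le.mpr (by
          rintro _ ⟨p, hp, x, hx, rfl⟩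
          exact S.mul_mem (hPS hp) (S.pow_mem hx 2))
      exact fun x hx ↦ this hx
    rcases eq_or_ne z 0 with rfl | hz0
    · exact ⟨t, ht, t', ht', by simpa using heq⟩
    · refine absurd ?_ hsS
      have : s = (-1 - t - a * t') / z := by
        rw [eq_div_iff hz0, heq]; ring
      rw [this]
      exact S.div_mem (S.sub_mem (S.sub_mem (S.neg_mem S.one_mem) (hcone t ht))
        (S.mul_mem ha (hcone t' ht'))) hz
  have hsqrtP : ∀ p ∈ P, ∃ s ∈ S, s ^ 2 = p := by
    intro p hp
    obtain ⟨s, hs⟩ := IsAlgClosed.exists_pow_nat_eq p two_pos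
    refine ⟨s, ?_, hs⟩
    by_contra hsS
    obtain ⟨t, ht, t', ht', heq⟩ := sqrt (hPS hp) hs hsS
    refine hSneg (heq ▸ add_mem ht (mul_mem_squareCone hmul ?_ ht'))
    exact AddSubmonoid.subset_closure ⟨p, hp, 1, S.one_mem, by ring⟩
  have hsqS : ∀ x ∈ S, x ^ 2 ∈ squareCone P S := fun x hx ↦
    AddSubmonoid.subset_closure ⟨1, hone, x, hx, by ring⟩
  have hsq : ∀ x : S, IsSquare x ∨ IsSquare (-x) := by
    intro x
    obtain ⟨s, hs⟩ := IsAlgClosed.exists_pow_nat_eq (x : Ω) two_pos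
    obtain ⟨s', hs'⟩ := IsAlgClosed.exists_pow_nat_eq (-x : Ω) two_pos
    by_cases h : s ∈ S
    · exact .inl ⟨⟨s, h⟩, Subtype.ext (by rw [← hs]; exact pow_two s)⟩
    by_cases h' : s' ∈ S
    · exact .inr ⟨⟨s', h'⟩, Subtype.ext (by
        change (-x : Ω) = _
        rw [← hs']; exact pow_two s')⟩
    obtain ⟨t, ht, t', ht', h1⟩ := sqrt x.2 hs h
    obtain ⟨u, hu, u', hu', h2⟩ := sqrt (S.neg_mem x.2) hs' h'
    refine absurd ?_ hSneg
    have : -1 = t + u + t * u + (x : Ω) ^ 2 * (t' * u') := by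
      linear_combination (1 + u) * h1 - x * t' * h2
    rw [this]
    exact add_mem (add_mem (add_mem ht hu) (mul_mem_squareCone hmul ht hu))
      (mul_mem_squareCone hmul (hsqS x x.2) (mul_mem_squareCone hmul ht' hu'))
  have hsemi : IsSemireal S := by
    refine IsSemireal.of_not_isSumSq_neg_one fun hss ↦ hSneg ?_
    have key : ∀ x : S, IsSumSq x → (x : Ω) ∈ squareCone P S := by
      intro x hx
      induction hx with
      | zero => exact zero_mem _
      | sq_add a _ ih =>
        refine add_mem ?_ ih
        have := hsqS a a.2
        rwa [pow_two] at this
    simpa using key _ hss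
  obtain ⟨_, _⟩ := exists_linearOrder_of_isSquare_or_isSquare_neg hsq
  have hIVP : PolynomialIVP S := by
    refine polynomialIVP_of_forall_irreducible fun f hf hss ↦ ?_
    have : Fact (Irreducible f) := ⟨hf⟩
    obtain ⟨θ, hθ⟩ := IsAlgClosed.exists_eval₂_eq_zero S.subtype f hf.degree_pos.ne'
    by_cases hθS : θ ∈ S
    · refine ⟨⟨θ, hθS⟩, Subtype.ext ?_⟩
      have := eval₂_at_apply S.subtype (p := f) ⟨θ, hθS⟩
      rw [Subfield.subtype_apply, hθ] at this
      exact this.symm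
    refine absurd ?_ hss
    let φ : AdjoinRoot f →+* Ω := AdjoinRoot.lift S.subtype θ hθ
    have hφ : ∀ g : S[X], φ (AdjoinRoot.mk _ g) = eval₂RingHom S.subtype θ g := fun g ↦
      AdjoinRoot.lift_mk _ _
    have key : ∀ x ∈ squareCone P (eval₂RingHom S.subtype θ).range, ∃ y, IsSumSq y ∧ φ y = x := by
      intro x hx
      induction hx using AddSubmonoid.closure_induction with
      | zero => exact ⟨0, .zero, map_zero _⟩
      | add x y _ _ hx hy =>
        obtain ⟨u, hu, rfl⟩ := hx
        obtain ⟨v, hv, rfl⟩ := hy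
        exact ⟨u + v, hu.add hv, map_add _ _ _⟩
      | mem x hx =>
        obtain ⟨p, hp, _, ⟨g, rfl⟩, rfl⟩ := hx
        obtain ⟨s, hs, rfl⟩ := hsqrtP p hp
        refine ⟨AdjoinRoot.mk f (C ⟨s, hs⟩ * g) * AdjoinRoot.mk f (C ⟨s, hs⟩ * g),
          IsSumSq.mul_self _, ?_⟩
        rw [map_mul, hφ]
        simp
        ring
    obtain ⟨y, hy, h⟩ := key _ (ext θ hθS)
    have : y = -1 := φ.injective (by rw [h, map_neg, map_one])
    rwa [← this]
  exact ⟨S, hkS, ⟨fun {x} ↦ hsq x, fun {f} hf ↦ hIVP.exists_isRoot_of_odd_natDegree hf⟩, hsqrtP⟩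

end

/-- Existence of real closures. -/
theorem exists_isRealClosed_of_cone {k : Type u} [Field k] {P : Set k}
    (hadd : ∀ a ∈ P, ∀ b ∈ P, a + b ∈ P) (hmul : ∀ a ∈ P, ∀ b ∈ P, a * b ∈ P)
    (hsq : ∀ a, a ^ 2 ∈ P) (hneg : -1 ∉ P) :
    ∃ (F : Type u) (_ : Field F) (_ : IsRealClosed F) (j : k →+* F), j.IsIntegral ∧
      ∀ p ∈ P, IsSquare (j p) := by
  let Ω := AlgebraicClosure k
  let i : k →+* Ω := algebraMap k Ω
  obtain ⟨S, hkS, hS, hsqrt⟩ := exists_isRealClosed_subfield (P := i '' P) (k₀ := i.fieldRange)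
    (by
      rintro _ ⟨a, ha, rfl⟩ _ ⟨b, hb, rfl⟩
      exact ⟨a * b, hmul a ha b hb, map_mul i a b⟩) ⟨1, by simpa using hsq 1, map_one i⟩
    (by
      rintro _ ⟨a, ha, rfl⟩
      exact ⟨a, rfl⟩)
    (fun x ↦ by
      obtain ⟨p, hp, hx⟩ := Algebra.IsIntegral.isIntegral (R := k) x
      exact ⟨p.map i.rangeRestrictField, hp.map _, by rw [eval₂_map]; exact hx⟩)
    (by
      have key : ∀ x ∈ squareCone (i '' P) i.fieldRange, x ∈ i '' P := by
        intro x hx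
        induction hx using AddSubmonoid.closure_induction with
        | zero => exact ⟨0, by simpa using hsq 0, map_zero i⟩
        | add x y _ _ hx hy =>
          obtain ⟨a, ha, rfl⟩ := hx
          obtain ⟨b, hb, rfl⟩ := hy
          exact ⟨a + b, hadd a ha b hb, map_add i a b⟩
        | mem x hx =>
          obtain ⟨_, ⟨p, hp, rfl⟩, _, ⟨y, rfl⟩, rfl⟩ := hx
          exact ⟨p * y ^ 2, hmul p hp _ (hsq y), by rw [map_mul, map_pow]⟩
      intro hc
      obtain ⟨a, ha, h⟩ := key _ hc
      have : a = -1 := i.injective (by rw [h, map_neg, map_one])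
      exact hneg (this ▸ ha))
  refine ⟨S, inferInstance, hS, i.codRestrict S fun a ↦ hkS ⟨a, rfl⟩, fun x ↦ ?_, fun p hp ↦ ?_⟩
  · obtain ⟨p, hp, hx⟩ := Algebra.IsIntegral.isIntegral (R := k) (x : Ω)
    refine ⟨p, hp, S.subtype.injective ?_⟩
    rw [hom_eval₂, map_zero]
    exact hx
  · obtain ⟨s, hs, h⟩ := hsqrt _ ⟨p, hp, rfl⟩
    exact ⟨⟨s, hs⟩, Subtype.ext (by
      change i p = s * s
      rw [← h, pow_two])⟩

section Real

theorem IsRealRing.of_injective {A B : Type*} [CommRing A] [CommRing B] (hB : IsRealRing B)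
    {f : A →+* B} (hf : Function.Injective f) : IsRealRing A := by
  intro n a h i
  have := hB n (f ∘ a) (by simpa using congrArg f h) i
  exact hf (by simpa using this)

theorem IsRealRing.pi {ι : Type*} {K : ι → Type*} [∀ i, CommRing (K i)]
    (hK : ∀ i, IsRealRing (K i)) : IsRealRing (∀ i, K i) := by
  intro n a h i
  funext p
  exact hK p n (fun i ↦ a i p) (by simpa using congrFun h p) i

theorem IsSumSq.exists_fin_sum {A : Type*} [CommRing A] {s : A} (hs : IsSumSq s) :
    ∃ (n : ℕ) (f : Fin n → A), s = ∑ i, f i ^ 2 := by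
  induction hs with
  | zero => exact ⟨0, 0, by simp⟩
  | sq_add a _ ih =>
    obtain ⟨n, f, rfl⟩ := ih
    exact ⟨n + 1, Fin.cons a f, by simp [Fin.sum_univ_succ, pow_two]⟩

theorem IsRealRing.eq_zero_of_mul_self_add {A : Type*} [CommRing A] (hA : IsRealRing A) {a s : A}
    (hs : IsSumSq s) (h : a * a + s = 0) : a = 0 := by
  obtain ⟨n, f, rfl⟩ := hs.exists_fin_sum
  exact hA (n + 1) (Fin.cons a f) (by simpa [Fin.sum_univ_succ, pow_two] using h) 0

theorem IsRealRing.eq_zero_of_sq_add_sq {A : Type*} [CommRing A] (hA : IsRealRing A) {a b : A}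
    (h : a ^ 2 + b ^ 2 = 0) : a = 0 :=
  hA.eq_zero_of_mul_self_add (IsSumSq.mul_self b) (by rw [← h]; ring)

theorem IsRealRing.isReduced {A : Type*} [CommRing A] (hA : IsRealRing A) : IsReduced A :=
  (isReduced_iff_pow_one_lt 2 one_lt_two).mpr fun _ h ↦ hA.eq_zero_of_sq_add_sq (b := 0) (by simpa using h)

theorem IsRealRing.isPartialOrdering {A : Type*} [CommRing A] (hA : IsRealRing A) :
    IsPartialOrdering {x : A | IsSumSq x} := by
  refine ⟨fun a ha b hb ↦ IsSumSq.add ha hb, fun a ha b hb ↦ IsSumSq.mul ha hb,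
    fun a ↦ by rw [pow_two]; exact .mul_self a, fun a ha hna ↦ ?_⟩
  obtain ⟨n, f, rfl⟩ := IsSumSq.exists_fin_sum ha
  refine Finset.sum_eq_zero fun i _ ↦ ?_
  rw [hA.eq_zero_of_mul_self_add (a := f i)
    (s := ∑ j ∈ Finset.univ.erase i, f j * f j + -∑ j, f j ^ 2)]
  · ring
  · exact (IsSumSq.sum_mul_self _ _).add hna
  · rw [← add_assoc, Finset.add_sum_erase _ (fun j ↦ f j * f j) (Finset.mem_univ i)]
    simp [pow_two]

theorem IsRealRing.sq_ne_neg_one {A : Type*} [CommRing A] [Nontrivial A] (hA : IsRealRing A)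
    (x : A) : x ^ 2 ≠ -1 := fun h ↦
  one_ne_zero (hA.eq_zero_of_sq_add_sq (a := 1) (b := x) (by rw [h]; ring))

end Real

section RealClosedField

variable {F : Type u} [Field F]

theorem IsRealClosedField.isRealClosed (h : IsRealClosedField F) : IsRealClosed F where
  isSquare_or_isSquare_neg x := (h.2.1 x).imp (fun ⟨y, hy⟩ ↦ ⟨y, by rw [← hy, pow_two]⟩)
    fun ⟨y, hy⟩ ↦ ⟨y, by rw [← hy, pow_two]⟩
  exists_isRoot_of_odd_natDegree hf := h.2.2 _ hf
  one_add_ne_zero hs h0 := one_ne_zero (h.1.eq_zero_of_mul_self_add hs (by rwa [mul_one]))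

theorem IsRealClosed.isRealClosedField [IsRealClosed F] : IsRealClosedField F := by
  refine ⟨?_, fun x ↦ (IsRealClosed.isSquare_or_isSquare_neg x).imp
    (fun ⟨y, hy⟩ ↦ ⟨y, by rw [hy, pow_two]⟩) fun ⟨y, hy⟩ ↦ ⟨y, by rw [hy, pow_two]⟩,
    fun p hp ↦ IsRealClosed.exists_isRoot_of_odd_natDegree hp⟩
  obtain ⟨_, _⟩ := IsRealClosed.exists_linearOrder F
  intro n f h i
  exact pow_eq_zero_iff two_ne_zero |>.mp
    ((Finset.sum_eq_zero_iff_of_nonneg fun i _ ↦ sq_nonneg (f i)).mp h i (Finset.mem_univ i))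

end RealClosedField

/-- Every element is, up to a sign `2 * e - 1` given by an idempotent `e`, a square, and every
monic polynomial of odd degree has a root. -/
structure HasRealClosedRoots (B : Type*) [CommRing B] : Prop where
  exists_sq (c : B) : ∃ e y : B, e * e = e ∧ c = (2 * e - 1) * y ^ 2
  exists_root (p : B[X]) : p.Monic → Odd p.natDegree → ∃ x, p.eval x = 0

namespace HasRealClosedRoots

theorem pi {ι : Type*} {K : ι → Type u} [∀ i, Field (K i)] (hK : ∀ i, IsRealClosedField (K i)) :
    HasRealClosedRoots (∀ i, K i) := by
  constructor
  · intro c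
    have h : ∀ i, ∃ e y : K i, e * e = e ∧ c i = (2 * e - 1) * y ^ 2 := by
      intro i
      rcases (hK i).2.1 (c i) with ⟨y, hy⟩ | ⟨y, hy⟩
      · exact ⟨1, y, by ring, by rw [hy]; ring⟩
      · exact ⟨0, y, by ring, by rw [hy]; ring⟩
    choose e y he hy using h
    exact ⟨e, y, funext he, funext hy⟩
  · intro p hp hodd
    have h : ∀ i, ∃ x, (p.map (Pi.evalRingHom K i)).eval x = 0 := fun i ↦
      (hK i).2.2 _ (by rwa [hp.natDegree_map])
    choose x hx using h
    refine ⟨x, funext fun i ↦ ?_⟩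
    have := eval₂_at_apply (Pi.evalRingHom K i) (p := p) x
    rw [← eval_map, Pi.evalRingHom_apply, hx] at this
    exact this.symm

theorem of_surjective {B C : Type*} [CommRing B] [CommRing C] (hB : HasRealClosedRoots B)
    {f : B →+* C} (hf : Function.Surjective f) : HasRealClosedRoots C := by
  constructor
  · intro c
    obtain ⟨b, rfl⟩ := hf c
    obtain ⟨e, y, he, hy⟩ := hB.exists_sq b
    exact ⟨f e, f y, by rw [← map_mul, he], by rw [hy]; simp [map_ofNat]⟩
  · intro p hp hodd
    obtain ⟨q, hq, hdeg, hmonic⟩ :=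
      lifts_and_natDegree_eq_and_monic ((lifts_iff_coeff_lifts p).mpr fun n ↦ hf _) hp
    obtain ⟨x, hx⟩ := hB.exists_root q hmonic (hdeg ▸ hodd)
    exact ⟨f x, by rw [← hq, eval_map, eval₂_at_apply, hx, map_zero]⟩

theorem isRealClosedField {F : Type u} [Field F] (hF : HasRealClosedRoots F) (hr : IsRealRing F) :
    IsRealClosedField F := by
  refine ⟨hr, fun x ↦ ?_, fun p hp ↦ ?_⟩
  · obtain ⟨e, y, he, rfl⟩ := hF.exists_sq x
    rcases eq_or_ne e 0 with rfl | h0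
    · exact .inr ⟨y, by ring⟩
    · exact .inl ⟨y, by rw [mul_left_cancel₀ h0 (he.trans (mul_one e).symm)]; ring⟩
  · have hp0 : p ≠ 0 := by rintro rfl; simp at hp
    obtain ⟨x, hx⟩ := hF.exists_root _ (monic_mul_leadingCoeff_inv hp0)
      (by rwa [natDegree_mul_leadingCoeff_inv _ hp0])
    rw [eval_mul, eval_C, mul_eq_zero, inv_eq_zero, leadingCoeff_eq_zero] at hx
    exact ⟨x, hx.resolve_right hp0⟩

end HasRealClosedRoots

namespace RingHom

/-- The subring of elements integral over the domain of a ring homomorphism. -/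
def integralClosure {A D : Type*} [CommRing A] [CommRing D] (h : A →+* D) : Subring D :=
  let := h.toAlgebra
  (_root_.integralClosure A D).toSubring

variable {A D : Type*} [CommRing A] [CommRing D] {h : A →+* D}

theorem mem_integralClosure {x : D} : x ∈ h.integralClosure ↔ h.IsIntegralElem x := Iff.rfl

theorem apply_mem_integralClosure (h : A →+* D) (a : A) : h a ∈ h.integralClosure :=
  h.isIntegralElem_map

/-- The structure map to the integral closure. -/
def toIntegralClosure (h : A →+* D) : A →+* h.integralClosure :=
  h.codRestrict _ h.apply_mem_integralClosure

theorem isIntegral_toIntegralClosure : h.toIntegralClosure.IsIntegral := by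
  intro x
  obtain ⟨p, hp, hx⟩ := mem_integralClosure.mp x.2
  refine ⟨p, hp, Subtype.ext ?_⟩
  change h.integralClosure.subtype _ = h.integralClosure.subtype 0
  rw [hom_eval₂, map_zero]
  exact hx

theorem mem_integralClosure_of_sq_mem {x : D} (hx : x ^ 2 ∈ h.integralClosure) :
    x ∈ h.integralClosure :=
  let := h.toAlgebra
  IsIntegral.of_pow (R := A) two_pos hx

end RingHom

theorem HasRealClosedRoots.integralClosure {A D : Type*} [CommRing A] [CommRing D] (h : A →+* D)
    (hD : HasRealClosedRoots D) : HasRealClosedRoots h.integralClosure := by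
  constructor
  · intro c
    obtain ⟨e, y, he, hy⟩ := hD.exists_sq c
    have hemem : e ∈ h.integralClosure := ⟨X ^ 2 - X, by monicity!, by simp [pow_two, he]⟩
    have hymem : y ∈ h.integralClosure := RingHom.mem_integralClosure_of_sq_mem (by
      have : y ^ 2 = (2 * e - 1) * c := by
        rw [hy]; linear_combination -4 * y ^ 2 * he
      rw [this]
      exact mul_mem (sub_mem (mul_mem (ofNat_mem _ 2) hemem) (one_mem _)) c.2)
    exact ⟨⟨e, hemem⟩, ⟨y, hymem⟩, Subtype.ext he, Subtype.ext hy⟩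
  · intro p hp hodd
    rcases subsingleton_or_nontrivial D with _ | _
    · exact ⟨0, Subtype.ext (Subsingleton.elim _ _)⟩
    obtain ⟨x, hx⟩ := hD.exists_root (p.map h.integralClosure.subtype) (hp.map _)
      (by rwa [hp.natDegree_map])
    have hxmem : x ∈ h.integralClosure := by
      let := h.toAlgebra
      have hx' : IsIntegral (_root_.integralClosure A D) x := ⟨p, hp, by rwa [eval_map] at hx⟩
      exact isIntegral_trans (R := A) x hx'
    refine ⟨⟨x, hxmem⟩, Subtype.ext ?_⟩
    have := eval₂_at_apply h.integralClosure.subtype (p := p) ⟨x, hxmem⟩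
    rw [← eval_map, Subring.subtype_apply, hx] at this
    exact this.symm

namespace IsVonNeumannRegular

variable {A B : Type*} [CommRing A] [CommRing B]

theorem exists_idempotent (hA : IsVonNeumannRegular A) (a : A) :
    ∃ e b, e * e = e ∧ e = a * b ∧ e * a = a := by
  obtain ⟨b, hb⟩ := hA a
  refine ⟨a * b, b, ?_, rfl, ?_⟩
  · linear_combination -b * hb
  · linear_combination -hb

theorem of_surjective (hA : IsVonNeumannRegular A) {f : A →+* B} (hf : Function.Surjective f) :
    IsVonNeumannRegular B := by
  intro b
  obtain ⟨a, rfl⟩ := hf b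
  obtain ⟨c, hc⟩ := hA a
  exact ⟨f c, by rw [← map_pow, ← map_mul, ← hc]⟩

theorem pi {ι : Type*} {K : ι → Type*} [∀ i, Field (K i)] : IsVonNeumannRegular (∀ i, K i) := by
  refine fun a ↦ ⟨fun i ↦ (a i)⁻¹, funext fun i ↦ ?_⟩
  rcases eq_or_ne (a i) 0 with h | h
  · simp [h]
  · simp [pow_two, h]

theorem isReduced (hA : IsVonNeumannRegular A) : IsReduced A :=
  (isReduced_iff_pow_one_lt 2 one_lt_two).mpr fun a h ↦ by
    obtain ⟨b, hb⟩ := hA a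
    rw [hb, h, zero_mul]

theorem isField [IsDomain A] (hA : IsVonNeumannRegular A) : IsField A where
  exists_pair_ne := exists_pair_ne A
  mul_comm := mul_comm
  mul_inv_cancel {a} ha := by
    obtain ⟨b, hb⟩ := hA a
    exact ⟨b, mul_left_cancel₀ ha (by linear_combination -hb)⟩

theorem isMaximal (hA : IsVonNeumannRegular A) (p : Ideal A) [p.IsPrime] : p.IsMaximal :=
  Ideal.Quotient.maximal_of_isField _ (hA.of_surjective Ideal.Quotient.mk_surjective).isField

theorem exists_idempotent_notMem (hA : IsVonNeumannRegular A) {p : Ideal A} (hp : p ≠ ⊤)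
    {x : A} (hx : x ∈ p) : ∃ e, e * e = e ∧ e ∉ p ∧ e * x = 0 := by
  obtain ⟨e, b, he, rfl, hex⟩ := hA.exists_idempotent x
  refine ⟨1 - x * b, by linear_combination he, fun h ↦ ?_, by linear_combination -hex⟩
  exact hp ((Ideal.eq_top_iff_one p).mpr (by simpa using add_mem h (p.mul_mem_right b hx)))

theorem mem_minimalPrimes (hA : IsVonNeumannRegular A) (p : Ideal A) [hp : p.IsPrime] :
    p ∈ minimalPrimes A := by
  rw [minimalPrimes_eq_minimals]
  refine ⟨hp, fun q hq hle ↦ ?_⟩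
  have : q.IsPrime := hq
  exact ((hA.isMaximal q).eq_of_le hp.ne_top hle).ge

theorem exists_prime_notMem (hA : IsVonNeumannRegular A) {a : A} (ha : a ≠ 0) :
    ∃ p : PrimeSpectrum A, a ∉ p.asIdeal := by
  by_contra! h
  have := hA.isReduced
  refine ha (IsNilpotent.eq_zero ?_)
  rw [← mem_nilradical, nilradical_eq_sInf, Ideal.mem_sInf]
  exact fun {p} hp ↦ h ⟨p, hp⟩

theorem isRealRing_quotient (hA : IsVonNeumannRegular A) (hr : IsRealRing A) (I : Ideal A) :
    IsRealRing (A ⧸ I) := by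
  intro n f h i
  choose g hg using fun i ↦ Ideal.Quotient.mk_surjective (f i)
  obtain rfl : (fun i ↦ Ideal.Quotient.mk I (g i)) = f := funext hg
  simp only [← map_pow, ← map_sum] at h
  rw [Ideal.Quotient.eq_zero_iff_mem] at h ⊢
  obtain ⟨e, b, he, hb, hec⟩ := hA.exists_idempotent (∑ i, g i ^ 2)
  have h0 := hr n (fun i ↦ (1 - e) * g i) (by
    simp only [mul_pow, ← Finset.mul_sum]
    linear_combination (e - 1) * hec) i
  have : g i = e * g i := by linear_combination h0
  rw [this, hb]
  exact I.mul_mem_right _ (I.mul_mem_right _ h)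

theorem of_isIntegral (hA : IsVonNeumannRegular A) [IsReduced B] {f : A →+* B}
    (hf : f.IsIntegral) : IsVonNeumannRegular B := by
  intro x
  let J : Ideal B := Ideal.span {x} ⊔ (Ideal.span {x}).annihilator
  by_cases hJ : J = ⊤
  · obtain ⟨y, hy, c, hc, hyc⟩ := Submodule.mem_sup.mp ((Ideal.eq_top_iff_one J).mp hJ)
    obtain ⟨b, rfl⟩ := Ideal.mem_span_singleton'.mp hy
    rw [Submodule.mem_annihilator_span_singleton, smul_eq_mul] at hc
    exact ⟨b, by linear_combination -x * hyc + hc⟩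
  obtain ⟨m, hm, hJm⟩ := Ideal.exists_le_maximal J hJ
  have hmin : m ∈ (Ideal.span {x}).annihilator.minimalPrimes := by
    refine ⟨⟨hm.isPrime, le_sup_right.trans hJm⟩, fun q hq hqm ↦ ?_⟩
    have : q.IsPrime := hq.1
    let := f.toAlgebra
    by_contra hc
    have hlt := Ideal.comap_lt_comap_of_integral_mem_sdiff (R := A) hqm
      (Set.not_subset.mp hc).choose_spec (hf _)
    have hmax := hA.isMaximal (q.comap (algebraMap A B))
    exact hlt.ne (hmax.eq_of_le (Ideal.IsPrime.under A m).ne_top hlt.le)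
  obtain ⟨y, hy, hxy⟩ := Ideal.exists_mul_mem_of_mem_minimalPrimes hmin (x := x)
    (hJm (Ideal.mem_sup_left (Ideal.mem_span_singleton_self x)))
  rw [Submodule.mem_annihilator_span_singleton, smul_eq_mul] at hy hxy
  refine absurd (IsReduced.eq_zero _ ⟨2, ?_⟩) hy
  linear_combination y * hxy

end IsVonNeumannRegular

namespace IsEssentialExtension

variable {A B C : Type*} [CommRing A] [CommRing B] [CommRing C] {f : A →+* B} {g : B →+* C}

theorem comp (hg : IsEssentialExtension g) (hf : IsEssentialExtension f) :
    IsEssentialExtension (g.comp f) := by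
  refine ⟨hg.1.comp hf.1, fun J hJ ↦ ?_⟩
  obtain ⟨b, hb, hb0⟩ := hg.2 J hJ
  obtain ⟨a, ha, ha0⟩ := hf.2 (J.comap g) fun h ↦ by
    have : b ∈ (⊥ : Ideal B) := h ▸ hb
    rw [Ideal.mem_bot] at this
    exact hb0 (by rw [this, map_zero])
  exact ⟨a, ha, fun h ↦ ha0 (hg.1 (by rw [map_zero]; exact h))⟩

theorem of_comp (h : IsEssentialExtension (g.comp f)) (hg : Function.Injective g) :
    IsEssentialExtension g :=
  ⟨hg, fun J hJ ↦ (h.2 J hJ).imp' f fun _ ↦ id⟩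

theorem injective_of_comp (hf : IsEssentialExtension f) (h : Function.Injective (g.comp f)) :
    Function.Injective g := by
  rw [injective_iff_map_eq_zero, ← RingHom.ker_eq_bot_iff_eq_zero]
  by_contra hc
  obtain ⟨a, ha, ha0⟩ := hf.2 _ hc
  have : a = 0 := h (by rw [map_zero]; exact ha)
  exact ha0 (by rw [this, map_zero])

theorem exists_of_idempotent (hf : IsEssentialExtension f) (hA : IsBaerRing A) {e : B}
    (he : e * e = e) : ∃ a, f a = e := by
  obtain ⟨g, hg, hann⟩ := hA {s | ∃ b, f s = e * b}
  have hgann := (hann g).mpr ⟨1, (mul_one g).symm⟩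
  have h1 : f g * e = 0 := by
    by_contra hc
    obtain ⟨a, ha, ha0⟩ := hf.2 (Ideal.span {f g * e}) (by simpa using hc)
    obtain ⟨b, hb⟩ := Ideal.mem_span_singleton'.mp ha
    have h0 : g * a = 0 := hgann a ⟨f g * b, by rw [← hb]; ring⟩
    refine ha0 ?_
    have h0' : f g * f a = 0 := by rw [← map_mul, h0, map_zero]
    have hg' : f g * f g = f g := by rw [← map_mul, hg]
    linear_combination h0' + (f g - 1) * hb - b * e * hg'
  have h2 : (1 - f g) * (1 - e) = 0 := by
    by_contra hc
    obtain ⟨a, ha, ha0⟩ := hf.2 (Ideal.span {(1 - f g) * (1 - e)}) (by simpa using hc)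
    obtain ⟨b, hb⟩ := Ideal.mem_span_singleton'.mp ha
    have hea : e * f a = 0 := by rw [← hb]; linear_combination -b * (1 - f g) * he
    have hg' : f g * f g = f g := by rw [← map_mul, hg]
    have hga : f g * f a = 0 := by rw [← hb]; linear_combination -b * (1 - e) * hg'
    obtain ⟨y, hy⟩ := (hann a).mp fun s ⟨b, hs⟩ ↦ hf.1 (by
      rw [map_mul, hs, map_zero]; linear_combination b * hea)
    have hga' : g * a = a := by rw [hy]; linear_combination y * hg
    exact ha0 (by rw [← hga', map_mul, hga])
  exact ⟨1 - g, by rw [map_sub, map_one]; linear_combination h2 - h1⟩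

end IsEssentialExtension

theorem exists_ideal_isEssentialExtension {A D : Type*} [CommRing A] [CommRing D] {f : A →+* D}
    (hf : Function.Injective f) :
    ∃ I : Ideal D, IsEssentialExtension ((Ideal.Quotient.mk I).comp f) := by
  obtain ⟨I, hI⟩ := zorn_le₀ {I : Ideal D | ∀ a, f a ∈ I → a = 0} (by
    intro c hc hchain
    rcases c.eq_empty_or_nonempty with rfl | hne
    · exact ⟨⊥, fun a ha ↦ hf (by simpa using ha), by simp⟩
    refine ⟨sSup c, fun a ha ↦ ?_, fun J hJ ↦ le_sSup hJ⟩
    obtain ⟨J, hJ, haJ⟩ := (Submodule.mem_sSup_of_directed hne hchain.directedOn).mp ha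
    exact hc hJ a haJ)
  refine ⟨I, ?_, fun J hJ ↦ ?_⟩
  · rw [injective_iff_map_eq_zero]
    exact fun a ha ↦ hI.prop a (Ideal.Quotient.eq_zero_iff_mem.mp ha)
  · by_contra! hc
    refine hJ (eq_bot_iff.mpr fun x hx ↦ ?_)
    obtain ⟨y, rfl⟩ := Ideal.Quotient.mk_surjective x
    rw [Ideal.mem_bot, Ideal.Quotient.eq_zero_iff_mem]
    refine hI.le_of_ge (y := J.comap (Ideal.Quotient.mk I)) (fun a ha ↦ ?_) (fun z hz ↦ ?_) hx
    · exact hI.prop a (Ideal.Quotient.eq_zero_iff_mem.mp (hc a ha))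
    · rw [Ideal.mem_comap, Ideal.Quotient.eq_zero_iff_mem.mpr hz]
      exact zero_mem _

theorem IsVonNeumannRegular.exists_comap_eq {A B : Type*} [CommRing A] [CommRing B]
    (hA : IsVonNeumannRegular A) {f : A →+* B} (hf : Function.Injective f) (p : Ideal A)
    [p.IsPrime] : ∃ q : Ideal B, q.IsPrime ∧ q.comap f = p :=
  Ideal.exists_comap_eq_of_mem_minimalPrimes_of_injective hf p (hA.mem_minimalPrimes p)

theorem IsPartialOrdering.exists_residue_isRealClosedField {A : Type u} [CommRing A] {P : Set A}
    (hP : IsPartialOrdering P) (hA : IsVonNeumannRegular A) (p : PrimeSpectrum A) :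
    ∃ (F : Type u) (_ : Field F) (κ : A →+* F), IsRealClosedField F ∧
      (∀ a, κ a = 0 ↔ a ∈ p.asIdeal) ∧ κ.IsIntegral ∧ ∀ a ∈ P, ∃ y, y ^ 2 = κ a := by
  obtain ⟨hadd, hmul, hsq, hneg⟩ := hP
  have := hA.isMaximal p.asIdeal
  let := Ideal.Quotient.field p.asIdeal
  let π := Ideal.Quotient.mk p.asIdeal
  have hπ : Function.Surjective π := Ideal.Quotient.mk_surjective
  obtain ⟨F, _, _, j, hj, hPj⟩ := exists_isRealClosed_of_cone (k := A ⧸ p.asIdeal) (P := π '' P)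
    (by
      rintro _ ⟨a, ha, rfl⟩ _ ⟨b, hb, rfl⟩
      exact ⟨a + b, hadd a ha b hb, map_add π a b⟩)
    (by
      rintro _ ⟨a, ha, rfl⟩ _ ⟨b, hb, rfl⟩
      exact ⟨a * b, hmul a ha b hb, map_mul π a b⟩)
    (by
      intro x
      obtain ⟨a, rfl⟩ := hπ x
      exact ⟨a ^ 2, hsq a, map_pow π a 2⟩)
    (by
      rintro ⟨a, ha, h⟩
      have h1 : 1 + a ∈ p.asIdeal := by
        rw [← Ideal.Quotient.eq_zero_iff_mem, map_add, map_one]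
        change 1 + π a = 0
        rw [h, add_neg_cancel]
      obtain ⟨e, he, hep, hea⟩ := hA.exists_idempotent_notMem p.2.ne_top h1
      have heP : e ∈ P := by rw [← he, ← pow_two]; exact hsq e
      have : -e ∈ P := by
        have := hmul e heP a ha
        rwa [show e * a = -e by linear_combination hea] at this
      rw [hneg e heP this] at hep
      exact hep (zero_mem _))
  refine ⟨F, inferInstance, j.comp π, IsRealClosed.isRealClosedField, fun a ↦ ?_, ?_, fun a ha ↦ ?_⟩
  · rw [RingHom.comp_apply, map_eq_zero, Ideal.Quotient.eq_zero_iff_mem]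
  · exact (RingHom.isIntegral_of_surjective π hπ).trans _ _ hj
  · obtain ⟨y, hy⟩ := hPj _ ⟨a, ha, rfl⟩
    exact ⟨y, by rw [pow_two, ← hy]; rfl⟩

theorem RingHom.IsIntegral.exists_eval₂_eq_zero {A F : Type*} [CommRing A] [Field F] {κ : A →+* F}
    (hκ : κ.IsIntegral) (x : F) : ∃ q : A[X], q.eval₂ κ x = 0 ∧ q.map κ ≠ 0 := by
  obtain ⟨q, hq, hx⟩ := hκ x
  exact ⟨q, hx, (hq.map κ).ne_zero⟩

theorem IsPartialOrdering.exists_isEpof {A : Type u} [CommRing A] {P : Set A}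
    (hP : IsPartialOrdering P) (hA : IsVonNeumannRegular A) :
    ∃ (K : PrimeSpectrum A → Type u) (_ : ∀ p, Field (K p)) (κ : ∀ p, A →+* K p),
      IsEpof A P K κ := by
  choose K inst κ hK hker hint hPκ using hP.exists_residue_isRealClosedField hA
  exact ⟨K, inst, κ, hker, hK, fun p ↦ (hint p).exists_eval₂_eq_zero, hPκ⟩

namespace IsEpof

variable {A : Type u} [CommRing A] {P : Set A} {K : PrimeSpectrum A → Type u} [∀ p, Field (K p)]
  {κ : ∀ p, A →+* K p}

theorem injective (h : IsEpof A P K κ) (hA : IsVonNeumannRegular A) :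
    Function.Injective (RingHom.pi κ) := by
  rw [injective_iff_map_eq_zero]
  intro a ha
  by_contra ha0
  obtain ⟨p, hp⟩ := hA.exists_prime_notMem ha0
  exact hp ((h.ker p a).mp (congrFun ha p))

theorem isRealRing (h : IsEpof A P K κ) : IsRealRing (∀ p, K p) := .pi fun p ↦ (h.rcf p).1

theorem exists_sq (h : IsEpof A P K κ) {a : A} (ha : a ∈ P) : ∃ y, y ^ 2 = RingHom.pi κ a := by
  choose y hy using fun p ↦ h.ordext p a ha
  exact ⟨y, funext hy⟩

end IsEpof

/-- A real ring whose residue fields are real closed is real closed * as soon as its idempotents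
come from a Baer subring over which it is integral and essential. -/
theorem HasRealClosedRoots.isRealClosedStar {A B : Type u} [CommRing A] [CommRing B] {f : A →+* B}
    (hB : HasRealClosedRoots B) (hr : IsRealRing B) (hf : IsEssentialExtension f)
    (hint : f.IsIntegral) (hBaer : IsBaerRing A) (hA : IsVonNeumannRegular A) :
    IsRealClosedStar B := by
  have := hr.isReduced
  have hBv := hA.of_isIntegral hint
  refine ⟨hr, fun C _ g hC hg hgint c ↦ ?_⟩
  have := hC.isReduced
  have hCv := hBv.of_isIntegral hgint
  let I : Ideal B :=
    { carrier := {b | ∃ d, g d = g b * c}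
      add_mem' := by
        rintro a b ⟨d, hd⟩ ⟨d', hd'⟩
        exact ⟨d + d', by rw [map_add, map_add, hd, hd', add_mul]⟩
      zero_mem' := ⟨0, by simp⟩
      smul_mem' := by
        rintro a b ⟨d, hd⟩
        exact ⟨a * d, by rw [map_mul, hd, smul_eq_mul, map_mul, mul_assoc]⟩ }
  by_cases hI : I = ⊤
  · obtain ⟨d, hd⟩ : (1 : B) ∈ I := hI ▸ Submodule.mem_top
    exact ⟨d, by rw [hd, map_one, one_mul]⟩
  obtain ⟨m, hm, hIm⟩ := Ideal.exists_le_maximal I hI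
  have := hm.isPrime
  obtain ⟨q, hq, hqm⟩ := hBv.exists_comap_eq hg.1 m
  have := hCv.isMaximal q
  let := Ideal.Quotient.field m
  let := Ideal.Quotient.field q
  have hrm := hBv.isRealRing_quotient hr m
  have hrq := hCv.isRealRing_quotient hC q
  have := ((hB.of_surjective (Ideal.Quotient.mk_surjective (I := m))).isRealClosedField
    hrm).isRealClosed
  let j : B ⧸ m →+* C ⧸ q := Ideal.quotientMap q g hqm.ge
  have hj : j.IsIntegral := by
    have h1 : (j.comp (Ideal.Quotient.mk m)).IsIntegral :=
      hgint.trans _ _ (RingHom.isIntegral_of_surjective _ Ideal.Quotient.mk_surjective)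
    exact h1.tower_top _ _
  obtain ⟨x, hx⟩ := IsRealClosed.ringHom_surjective_of_forall_sq_ne_neg_one j hj
    hrq.sq_ne_neg_one (Ideal.Quotient.mk q c)
  obtain ⟨b, rfl⟩ := Ideal.Quotient.mk_surjective x
  have hmem : c - g b ∈ q := by
    rw [← Ideal.Quotient.eq_zero_iff_mem, map_sub, ← hx]
    exact sub_self _
  obtain ⟨e, he, heq, hec⟩ := hCv.exists_idempotent_notMem hq.ne_top hmem
  obtain ⟨a, rfl⟩ := (hg.comp hf).exists_of_idempotent hBaer he
  refine absurd ?_ heq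
  have hfa : f a ∈ m := hIm ⟨f a * b, by
    rw [map_mul]
    rw [RingHom.comp_apply] at hec
    linear_combination -hec⟩
  rw [← hqm] at hfa
  exact hfa

theorem IsRealClosedStar.hasRealClosedRoots {B : Type u} [CommRing B] (hB : IsRealClosedStar B)
    (hv : IsVonNeumannRegular B) : HasRealClosedRoots B := by
  obtain ⟨K, _, κ, h⟩ := hB.1.isPartialOrdering.exists_isEpof hv
  let i := RingHom.pi κ
  have hint : i.toIntegralClosure.IsIntegral := RingHom.isIntegral_toIntegralClosure
  have hinj : Function.Injective i.toIntegralClosure := fun a b hab ↦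
    h.injective hv (congrArg Subtype.val hab)
  have hreal : IsRealRing i.integralClosure :=
    h.isRealRing.of_injective i.integralClosure.subtype_injective
  have := hreal.isReduced
  have hCv := hv.of_isIntegral hint
  obtain ⟨I, hI⟩ := exists_ideal_isEssentialExtension hinj
  have hsurj := hB.2 _ _ (hCv.isRealRing_quotient hreal I) hI
    (hint.trans _ _ (RingHom.isIntegral_of_surjective _ Ideal.Quotient.mk_surjective))
  let e := RingEquiv.ofBijective _ ⟨hI.1, hsurj⟩
  exact (((HasRealClosedRoots.pi h.rcf).integralClosure i).of_surjective
    (Ideal.Quotient.mk_surjective (I := I))).of_surjective (f := e.symm.toRingHom) e.symm.surjective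

theorem IsEssentialExtension.toIntegralClosure {A D : Type*} [CommRing A] [CommRing D]
    {h : A →+* D} (hh : IsEssentialExtension h) (hv : IsVonNeumannRegular h.integralClosure) :
    IsEssentialExtension h.toIntegralClosure := by
  refine ⟨fun a b hab ↦ hh.1 (congrArg Subtype.val hab), fun J hJ ↦ ?_⟩
  obtain ⟨c, hc, hc0⟩ := Submodule.exists_mem_ne_zero_of_ne_bot hJ
  obtain ⟨e, b, he, hcb, hec⟩ := hv.exists_idempotent c
  have he0 : (e : D) ≠ 0 := fun h0 ↦ hc0 (by
    rw [← hec, show e = 0 from Subtype.ext h0, zero_mul])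
  obtain ⟨a, ha, ha0⟩ := hh.2 (Ideal.span {(e : D)}) (by simpa using he0)
  refine ⟨a, ?_, fun h0 ↦ ha0 (congrArg Subtype.val h0)⟩
  obtain ⟨d, hd⟩ := Ideal.mem_span_singleton'.mp ha
  have he' : (e : D) * e = e := congrArg Subtype.val he
  have : h.toIntegralClosure a = e * h.toIntegralClosure a := Subtype.ext (by
    change h a = e * h a
    linear_combination (e - 1 : D) * hd - d * he')
  rw [this, hcb]
  exact J.mul_mem_right _ (J.mul_mem_right _ hc)

theorem IsEssentialExtension.isRealClosureStarOf {A D : Type u} [CommRing A] [CommRing D]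
    {P : Set A} {h : A →+* D} (hh : IsEssentialExtension h) (hBaer : IsBaerRing A)
    (hA : IsVonNeumannRegular A) (hD : IsRealRing D) (hroots : HasRealClosedRoots D)
    (hP : ∀ a ∈ P, ∃ y, y ^ 2 = h a) :
    IsRealClosureStarOf A P h.integralClosure {x | IsSumSq x} h.toIntegralClosure := by
  have hint := h.isIntegral_toIntegralClosure
  have hreal : IsRealRing h.integralClosure := hD.of_injective h.integralClosure.subtype_injective
  have := hreal.isReduced
  have hess := hh.toIntegralClosure (hA.of_isIntegral hint)
  refine ⟨hreal.isPartialOrdering, (hroots.integralClosure h).isRealClosedStar hreal hess hint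
    hBaer hA, hess, hint, fun a ha ↦ ?_⟩
  obtain ⟨y, hy⟩ := hP a ha
  have hymem : y ∈ h.integralClosure := RingHom.mem_integralClosure_of_sq_mem (by
    rw [hy]; exact h.apply_mem_integralClosure a)
  have : h.toIntegralClosure a = ⟨y, hymem⟩ * ⟨y, hymem⟩ := Subtype.ext (by
    change h a = y * y
    rw [← hy, pow_two])
  rw [this]
  exact IsSumSq.mul_self _

theorem IsRealRing.eq_zero_of_add_add_mul_self {A : Type*} [CommRing A] (hA : IsRealRing A)
    {a b c : A} (h : a * a + b * b + c * c = 0) : a = 0 ∧ b = 0 ∧ c = 0 := by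
  refine ⟨hA.eq_zero_of_mul_self_add (.add (.mul_self b) (.mul_self c)) (by linear_combination h),
    hA.eq_zero_of_mul_self_add (.add (.mul_self a) (.mul_self c)) (by linear_combination h),
    hA.eq_zero_of_mul_self_add (.add (.mul_self a) (.mul_self b)) (by linear_combination h)⟩

/-- The prime cone of elements that become squares in a real closed field. -/
def PrimeCone.ofIsRealClosed {A F : Type u} [CommRing A] [Field F] (hF : IsRealClosedField F)
    (j : A →+* F) : PrimeCone A where
  carrier := {a | IsSquare (j a)}
  add_mem := by
    rintro a ⟨x, hx⟩ b ⟨y, hy⟩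
    obtain ⟨z, hz⟩ | ⟨z, hz⟩ := hF.2.1 (j (a + b))
    · exact ⟨z, by rw [← hz, pow_two]⟩
    · obtain ⟨-, -, rfl⟩ := hF.1.eq_zero_of_add_add_mul_self (a := x) (b := y) (c := z) (by
        rw [map_add] at hz
        linear_combination hz - hx - hy)
      exact ⟨0, by linear_combination hz⟩
  mul_mem a ha b hb := by
    rw [Set.mem_ofPred_eq, map_mul]
    exact IsSquare.mul ha hb
  sq_mem a := ⟨j a, by rw [map_pow, pow_two]⟩
  mem_or_neg_mem a := by
    obtain ⟨z, hz⟩ | ⟨z, hz⟩ := hF.2.1 (j a)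
    · exact .inl ⟨z, by rw [← hz, pow_two]⟩
    · exact .inr ⟨z, by rw [map_neg, ← hz, pow_two]⟩
  support := RingHom.ker j
  mem_support a := by
    refine ⟨fun h ↦ ?_, ?_⟩
    · rw [RingHom.mem_ker] at h
      exact ⟨⟨0, by simp [h]⟩, ⟨0, by simp [h]⟩⟩
    · rintro ⟨⟨x, hx⟩, y, hy⟩
      rw [map_neg] at hy
      have := hF.1.eq_zero_of_sq_add_sq (a := x) (b := y) (by linear_combination -hx - hy)
      rw [RingHom.mem_ker, hx, this, mul_zero]
  support_isPrime := RingHom.ker_isPrime j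

/-- The points of the real spectrum of `A` induced by the points of `D`, when the residue rings
of `D` are ordered by their squares. -/
def RingHom.squareSpectrum {A D : Type u} [CommRing A] [CommRing D] (P : Set A) (h : A →+* D) :
    Set (RealSpectrum A P) :=
  {α | ∃ q : Ideal D, q.IsPrime ∧ ∀ a, a ∈ α.1.carrier ↔ IsSquare (Ideal.Quotient.mk q (h a))}

theorem HasRealClosedRoots.isSquare_mk_comap {B D : Type u} [CommRing B] [CommRing D]
    (hB : HasRealClosedRoots B) (g : B →+* D) (q : Ideal D) [q.IsPrime] (hq : IsRealRing (D ⧸ q))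
    (b : B) : IsSquare (Ideal.Quotient.mk q (g b)) ↔ IsSquare (Ideal.Quotient.mk (q.comap g) b) := by
  let π := (Ideal.Quotient.mk q).comp g
  have hker : ∀ x, Ideal.Quotient.mk (q.comap g) x = 0 ↔ π x = 0 := fun x ↦ by
    rw [Ideal.Quotient.eq_zero_iff_mem, Ideal.mem_comap, ← Ideal.Quotient.eq_zero_iff_mem]
    rfl
  constructor
  · rintro ⟨y, hy⟩
    obtain ⟨e, z, he, rfl⟩ := hB.exists_sq b
    change π _ = _ at hy
    have he' : π e * (π e - 1) = 0 := by rw [mul_sub, ← map_mul, he, mul_one, sub_self]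
    obtain h0 | h1 := mul_eq_zero.mp he'
    · have hz : π z = 0 := hq.eq_zero_of_sq_add_sq (b := y) (by
        simp only [map_mul, map_sub, map_one, map_pow, map_ofNat, h0] at hy
        linear_combination -hy)
      refine ⟨0, ?_⟩
      rw [mul_zero, hker]
      simp [hz]
    · refine ⟨Ideal.Quotient.mk _ z, ?_⟩
      rw [← map_mul, ← sub_eq_zero, ← map_sub, hker]
      simp only [map_mul, map_sub, map_one, map_pow, map_ofNat]
      linear_combination 2 * (π z) ^ 2 * h1
  · exact fun h ↦ h.map (Ideal.quotientMap q g le_rfl)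

theorem HasRealClosedRoots.squareSpectrum_comp {A B D : Type u} [CommRing A] [CommRing B]
    [CommRing D] (P : Set A) (hB : HasRealClosedRoots B) (hBv : IsVonNeumannRegular B)
    (hD : IsRealRing D) (hDv : IsVonNeumannRegular D) {g : B →+* D} (hg : Function.Injective g)
    (f : A →+* B) : (g.comp f).squareSpectrum P = f.squareSpectrum P := by
  ext α
  constructor
  · rintro ⟨q, hq, h⟩
    refine ⟨q.comap g, inferInstance, fun a ↦ (h a).trans ?_⟩
    exact hB.isSquare_mk_comap g q (hDv.isRealRing_quotient hD q) (f a)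
  · rintro ⟨p, hp, h⟩
    obtain ⟨q, hq, rfl⟩ := hBv.exists_comap_eq hg p
    refine ⟨q, hq, fun a ↦ (h a).trans ?_⟩
    exact (hB.isSquare_mk_comap g q (hDv.isRealRing_quotient hD q) (f a)).symm

theorem HasRealClosedRoots.mem_squareSpectrum_quotient {A D : Type u} [CommRing A] [CommRing D]
    {P : Set A} (hD : HasRealClosedRoots D) (hr : IsRealRing D) (hv : IsVonNeumannRegular D)
    (h : A →+* D) (I : Ideal D) (α : RealSpectrum A P) :
    α ∈ ((Ideal.Quotient.mk I).comp h).squareSpectrum P ↔ ∃ q : Ideal D, q.IsPrime ∧ I ≤ q ∧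
      ∀ a, a ∈ α.1.carrier ↔ IsSquare (Ideal.Quotient.mk q (h a)) := by
  have hIv := hv.of_surjective (Ideal.Quotient.mk_surjective (I := I))
  have hIr := hv.isRealRing_quotient hr I
  constructor
  · rintro ⟨q, hq, hα⟩
    refine ⟨q.comap (Ideal.Quotient.mk I), inferInstance, fun x hx ↦ ?_, fun a ↦ (hα a).trans
      (hD.isSquare_mk_comap (Ideal.Quotient.mk I) q (hIv.isRealRing_quotient hIr q) (h a))⟩
    rw [Ideal.mem_comap, Ideal.Quotient.eq_zero_iff_mem.mpr hx]
    exact zero_mem _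
  · rintro ⟨p, hp, hI, hα⟩
    have hq : (p.map (Ideal.Quotient.mk I)).IsPrime :=
      Ideal.map_isPrime_of_surjective Ideal.Quotient.mk_surjective (by rwa [Ideal.mk_ker])
    have hqp : (p.map (Ideal.Quotient.mk I)).comap (Ideal.Quotient.mk I) = p := by
      rw [Ideal.comap_map_of_surjective' _ Ideal.Quotient.mk_surjective, Ideal.mk_ker,
        sup_eq_left.mpr hI]
    refine ⟨_, hq, fun a ↦ (hα a).trans ?_⟩
    rw [RingHom.comp_apply, hD.isSquare_mk_comap _ _ (hIv.isRealRing_quotient hIr _), hqp]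

theorem RhoIsoIntegralClosure.mem_iff {A D : Type u} [CommRing A] [CommRing D] [IsDomain D]
    {α : PrimeCone A} {h : A →+* D} (r : RhoIsoIntegralClosure A α D h) (a : A) :
    a ∈ α.carrier ↔ IsSquare (h a) := by
  let := r.fieldF
  rw [← r.ord]
  constructor
  · rintro ⟨y, hy⟩
    exact ⟨r.e y, by rw [← r.comm, ← hy, pow_two, map_mul]⟩
  · rintro ⟨y, hy⟩
    have hy' : y ∈ Set.range r.e := by
      rw [r.range_ic]
      refine RingHom.mem_integralClosure_of_sq_mem (h := h) ?_
      rw [pow_two, ← hy]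
      exact h.apply_mem_integralClosure a
    obtain ⟨x, rfl⟩ := hy'
    refine ⟨x, r.e.injective ?_⟩
    rw [r.comm, hy, pow_two, map_mul]

theorem HasRealClosedRoots.nonempty_rhoIsoIntegralClosure {A D : Type u} [CommRing A] [CommRing D]
    [IsDomain D] (hA : IsVonNeumannRegular A) (hD : HasRealClosedRoots D) (hr : IsRealRing D)
    {α : PrimeCone A} {h : A →+* D} (hα : ∀ a, a ∈ α.carrier ↔ IsSquare (h a)) :
    Nonempty (RhoIsoIntegralClosure A α D h) := by
  have hint := h.isIntegral_toIntegralClosure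
  have hfield := (hA.of_isIntegral hint).isField
  let := hfield.toField
  exact ⟨{
    F := h.integralClosure
    j := h.toIntegralClosure
    rcf := (hD.integralClosure h).isRealClosedField
      (hr.of_injective h.integralClosure.subtype_injective)
    ord := fun a ↦ by
      rw [hα]
      constructor
      · rintro ⟨y, hy⟩
        exact ⟨y, (congrArg Subtype.val hy).symm.trans (pow_two _)⟩
      · rintro ⟨y, hy⟩
        refine ⟨⟨y, RingHom.mem_integralClosure_of_sq_mem ?_⟩, Subtype.ext ?_⟩
        · rw [pow_two, ← hy]
          exact h.apply_mem_integralClosure a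
        · exact (pow_two y).trans hy.symm
    alg := fun x ↦ hint.exists_eval₂_eq_zero x
    e := h.integralClosure.subtype
    comm := fun _ ↦ rfl
    range_ic := Subtype.range_coe }⟩

theorem PrimeCone.support_eq_ker {A D : Type u} [CommRing A] [CommRing D] (hr : IsRealRing D)
    {α : PrimeCone A} {h : A →+* D} (hα : ∀ a, a ∈ α.carrier ↔ IsSquare (h a)) :
    α.support = RingHom.ker h := by
  ext a
  rw [α.mem_support, hα, hα, map_neg, RingHom.mem_ker]
  constructor
  · rintro ⟨⟨x, hx⟩, y, hy⟩
    rw [hx, hr.eq_zero_of_sq_add_sq (a := x) (b := y) (by linear_combination -hx - hy), mul_zero]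
  · intro ha
    rw [ha, neg_zero]
    exact ⟨.zero, .zero⟩

theorem IsEpof.setOf_rhoIso_eq_squareSpectrum {A : Type u} [CommRing A] {P : Set A}
    {K : PrimeSpectrum A → Type u} [∀ p, Field (K p)] {κ : ∀ p, A →+* K p}
    (h : IsEpof A P K κ) (hA : IsVonNeumannRegular A) (I : Ideal (∀ p, K p)) :
    {α : RealSpectrum A P | ∃ 𝔭 : Ideal (∀ p, K p), 𝔭.IsPrime ∧ I ≤ 𝔭 ∧
      Ideal.map (RingHom.pi κ) α.1.support ≤ 𝔭 ∧
      Nonempty (RhoIsoIntegralClosure A α.1 ((∀ p, K p) ⧸ 𝔭)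
        ((Ideal.Quotient.mk 𝔭).comp (RingHom.pi κ)))} =
    ((Ideal.Quotient.mk I).comp (RingHom.pi κ)).squareSpectrum P := by
  have hroots := HasRealClosedRoots.pi h.rcf
  have hv : IsVonNeumannRegular (∀ p, K p) := .pi
  ext α
  rw [hroots.mem_squareSpectrum_quotient h.isRealRing hv]
  constructor
  · rintro ⟨q, hq, hI, -, ⟨r⟩⟩
    exact ⟨q, hq, hI, r.mem_iff⟩
  · rintro ⟨q, hq, hI, hα⟩
    have hqr := hv.isRealRing_quotient h.isRealRing q
    refine ⟨q, hq, hI, ?_, (hroots.of_surjective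
      Ideal.Quotient.mk_surjective).nonempty_rhoIsoIntegralClosure hA hqr hα⟩
    rw [Ideal.map_le_iff_le_comap]
    refine (PrimeCone.support_eq_ker hqr (h := (Ideal.Quotient.mk q).comp (RingHom.pi κ)) hα).le.trans
      fun a ha ↦ ?_
    exact (Ideal.Quotient.eq_zero_iff_mem (I := q)).mp ha

namespace IsRealClosureStarOf

variable {A B C : Type u} [CommRing A] [CommRing B] [CommRing C] {P : Set A} {Q : Set B}
  {R : Set C} {f : A →+* B} {g : A →+* C}

theorem isVonNeumannRegular (hB : IsRealClosureStarOf A P B Q f) (hA : IsVonNeumannRegular A) :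
    IsVonNeumannRegular B :=
  have := hB.rcs.1.isReduced
  hA.of_isIntegral hB.integral

theorem hasRealClosedRoots (hB : IsRealClosureStarOf A P B Q f) (hA : IsVonNeumannRegular A) :
    HasRealClosedRoots B :=
  hB.rcs.hasRealClosedRoots (hB.isVonNeumannRegular hA)

theorem mem_pos_iff (hB : IsRealClosureStarOf A P B Q f) (hA : IsVonNeumannRegular A) (b : B) :
    b ∈ Q ↔ IsSquare b := by
  obtain ⟨-, hmul, hsq, hneg⟩ := hB.pos_partial
  constructor
  · intro hb
    obtain ⟨e, y, he, rfl⟩ := (hB.hasRealClosedRoots hA).exists_sq b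
    have h1 : ((1 - e) * y) ^ 2 = 0 := hneg _ (hsq _) (by
      have := hmul _ (hsq (1 - e)) _ hb
      rwa [show (1 - e) ^ 2 * ((2 * e - 1) * y ^ 2) = -((1 - e) * y) ^ 2 by
        linear_combination 2 * (e - 1) * y ^ 2 * he] at this)
    exact ⟨e * y, by linear_combination -h1⟩
  · rintro ⟨y, rfl⟩
    rw [← pow_two]
    exact hsq y

/-- Real closures * that embed over `A` into a common real von Neumann regular ring are
isomorphic over `A`. -/
theorem exists_ringEquiv_of_comp_eq {E : Type u} [CommRing E]
    (hB : IsRealClosureStarOf A P B Q f) (hC : IsRealClosureStarOf A P C R g)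
    (hA : IsVonNeumannRegular A) (hE : IsRealRing E) {v : B →+* E} {u : C →+* E}
    (huv : v.comp f = u.comp g) (hinj : Function.Injective (v.comp f)) :
    ∃ e : B ≃+* C, ∀ a, e (f a) = g a := by
  let h := v.comp f
  have hvmem : ∀ b, v b ∈ h.integralClosure := fun b ↦ by
    obtain ⟨p, hp, hpb⟩ := hB.integral b
    exact ⟨p, hp, by change eval₂ (v.comp f) _ _ = 0; rw [← hom_eval₂, hpb, map_zero]⟩
  have humem : ∀ c, u c ∈ h.integralClosure := fun c ↦ by
    obtain ⟨p, hp, hpc⟩ := hC.integral c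
    exact ⟨p, hp, by change eval₂ (v.comp f) _ _ = 0; rw [huv, ← hom_eval₂, hpc, map_zero]⟩
  have hint := h.isIntegral_toIntegralClosure
  have hreal : IsRealRing h.integralClosure := hE.of_injective h.integralClosure.subtype_injective
  have := hreal.isReduced
  have hv := hA.of_isIntegral hint
  have hinj' : Function.Injective h.toIntegralClosure := fun a b hab ↦
    hinj (congrArg Subtype.val hab)
  obtain ⟨I, hI⟩ := exists_ideal_isEssentialExtension hinj'
  let π := Ideal.Quotient.mk I
  have hπint := hint.trans _ π (RingHom.isIntegral_of_surjective _ Ideal.Quotient.mk_surjective)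
  have hπreal := hv.isRealRing_quotient hreal I
  let v' : B →+* h.integralClosure ⧸ I := π.comp (v.codRestrict _ hvmem)
  let u' : C →+* h.integralClosure ⧸ I := π.comp (u.codRestrict _ humem)
  have hv' : v'.comp f = π.comp h.toIntegralClosure := rfl
  have hu' : u'.comp g = π.comp h.toIntegralClosure := by
    ext a
    exact congrArg π (Subtype.ext (RingHom.congr_fun huv a).symm)
  have hvinj : Function.Injective v' := hB.essential.injective_of_comp (by rw [hv']; exact hI.1)
  have huinj : Function.Injective u' := hC.essential.injective_of_comp (by rw [hu']; exact hI.1)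
  have hvsurj : Function.Surjective v' := hB.rcs.2 _ v' hπreal
    (IsEssentialExtension.of_comp (f := f) (by rw [hv']; exact hI) hvinj)
    (RingHom.IsIntegral.tower_top f v' (by rw [hv']; exact hπint))
  have husurj : Function.Surjective u' := hC.rcs.2 _ u' hπreal
    (IsEssentialExtension.of_comp (f := g) (by rw [hu']; exact hI) huinj)
    (RingHom.IsIntegral.tower_top g u' (by rw [hu']; exact hπint))
  refine ⟨(RingEquiv.ofBijective v' ⟨hvinj, hvsurj⟩).trans
    (RingEquiv.ofBijective u' ⟨huinj, husurj⟩).symm, fun a ↦ ?_⟩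
  rw [RingEquiv.trans_apply, RingEquiv.symm_apply_eq]
  exact (RingHom.congr_fun hv' a).trans (RingHom.congr_fun hu' a).symm

theorem exists_mem_squareSpectrum (hB : IsRealClosureStarOf A P B Q f) (hA : IsVonNeumannRegular A)
    (q : Ideal B) [hq : q.IsPrime] : ∃ α ∈ f.squareSpectrum P,
      ∀ a, a ∈ α.1.carrier ↔ IsSquare (Ideal.Quotient.mk q (f a)) := by
  have hv := hB.isVonNeumannRegular hA
  have := hv.isMaximal q
  let := Ideal.Quotient.field q
  have hF := ((hB.hasRealClosedRoots hA).of_surjective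
    (Ideal.Quotient.mk_surjective (I := q))).isRealClosedField (hv.isRealRing_quotient hB.rcs.1 q)
  refine ⟨⟨PrimeCone.ofIsRealClosed hF ((Ideal.Quotient.mk q).comp f), fun a ha ↦ ?_⟩,
    ⟨q, hq, fun a ↦ Iff.rfl⟩, fun a ↦ Iff.rfl⟩
  exact ((hB.mem_pos_iff hA _).mp (hB.mono a ha)).map (Ideal.Quotient.mk q)

theorem exists_ringHom_quotient (hB : IsRealClosureStarOf A P B Q f)
    (hC : IsRealClosureStarOf A P C R g) (hA : IsVonNeumannRegular A)
    (hBC : f.squareSpectrum P = g.squareSpectrum P) (p : PrimeSpectrum A) :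
    ∃ (F : Type u) (_ : Field F) (v : B →+* F) (u : C →+* F), IsRealRing F ∧
      v.comp f = u.comp g ∧ RingHom.ker (v.comp f) = p.asIdeal := by
  have hBv := hB.isVonNeumannRegular hA
  have hCv := hC.isVonNeumannRegular hA
  obtain ⟨q, hq, hqp⟩ := hA.exists_comap_eq hB.essential.1 p.asIdeal
  obtain ⟨α, hα, hαq⟩ := hB.exists_mem_squareSpectrum hA q
  rw [hBC] at hα
  obtain ⟨r, hr, hαr⟩ := hα
  have := hA.isMaximal p.asIdeal
  have := hBv.isMaximal q
  have := hCv.isMaximal r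
  let := Ideal.Quotient.field p.asIdeal
  let := Ideal.Quotient.field q
  let := Ideal.Quotient.field r
  have hqr := hBv.isRealRing_quotient hB.rcs.1 q
  have hrr := hCv.isRealRing_quotient hC.rcs.1 r
  have := (((hB.hasRealClosedRoots hA).of_surjective
    (Ideal.Quotient.mk_surjective (I := q))).isRealClosedField hqr).isRealClosed
  have := (((hC.hasRealClosedRoots hA).of_surjective
    (Ideal.Quotient.mk_surjective (I := r))).isRealClosedField hrr).isRealClosed
  have hker₁ := PrimeCone.support_eq_ker hqr (h := (Ideal.Quotient.mk q).comp f) hαq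
  have hker₂ := PrimeCone.support_eq_ker hrr (h := (Ideal.Quotient.mk r).comp g) hαr
  have hrp : r.comap g = p.asIdeal := by
    ext a
    have := congrArg (a ∈ ·) (hker₁.symm.trans hker₂)
    simp only [RingHom.mem_ker, RingHom.comp_apply, Ideal.Quotient.eq_zero_iff_mem] at this
    rw [← hqp, Ideal.mem_comap, Ideal.mem_comap, this]
  let j₁ := Ideal.quotientMap q f hqp.ge
  let j₂ := Ideal.quotientMap r g hrp.ge
  have hj₁ : j₁.IsIntegral :=
    RingHom.IsIntegral.tower_top (Ideal.Quotient.mk p.asIdeal) j₁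
      (hB.integral.trans _ _ (RingHom.isIntegral_of_surjective (Ideal.Quotient.mk q)
        Ideal.Quotient.mk_surjective))
  obtain ⟨φ, hφ⟩ := IsRealClosed.exists_ringHom_comp_eq (j₂ := j₂) hj₁ (fun x ↦ by
    obtain ⟨a, rfl⟩ := Ideal.Quotient.mk_surjective x
    exact (hαq a).symm.trans (hαr a))
  have hcomp : (φ.comp (Ideal.Quotient.mk q)).comp f = (Ideal.Quotient.mk r).comp g := by
    ext a
    exact RingHom.congr_fun hφ (Ideal.Quotient.mk _ a)
  refine ⟨C ⧸ r, inferInstance, φ.comp (Ideal.Quotient.mk q), Ideal.Quotient.mk r, hrr, hcomp, ?_⟩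
  rw [hcomp, ← hrp]
  ext a
  exact Ideal.Quotient.eq_zero_iff_mem

theorem exists_ringEquiv_of_squareSpectrum_eq (hB : IsRealClosureStarOf A P B Q f)
    (hC : IsRealClosureStarOf A P C R g) (hA : IsVonNeumannRegular A)
    (hBC : f.squareSpectrum P = g.squareSpectrum P) :
    ∃ e : B ≃+* C, (∀ a, e (f a) = g a) ∧ ∀ b, b ∈ Q ↔ e b ∈ R := by
  choose F inst v u hF huv hker using hB.exists_ringHom_quotient hC hA hBC
  obtain ⟨e, he⟩ := hB.exists_ringEquiv_of_comp_eq hC hA (E := ∀ p, F p) (v := RingHom.pi v)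
    (u := RingHom.pi u) (.pi hF) (by
      ext a p
      exact RingHom.congr_fun (huv p) a) (by
      rw [injective_iff_map_eq_zero]
      intro a ha
      by_contra ha0
      obtain ⟨p, hp⟩ := hA.exists_prime_notMem ha0
      rw [← hker] at hp
      exact hp (congrFun ha p))
  refine ⟨e, he, fun b ↦ ?_⟩
  rw [hB.mem_pos_iff hA, hC.mem_pos_iff hA]
  refine ⟨fun h ↦ h.map e, fun h ↦ ?_⟩
  simpa using h.map e.symm

theorem squareSpectrum_eq_of_ringEquiv (hB : IsRealClosureStarOf A P B Q f)
    (hC : IsRealClosureStarOf A P C R g) (hA : IsVonNeumannRegular A) (e : B ≃+* C)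
    (he : ∀ a, e (f a) = g a) : f.squareSpectrum P = g.squareSpectrum P := by
  rw [← (hB.hasRealClosedRoots hA).squareSpectrum_comp P (hB.isVonNeumannRegular hA) hC.rcs.1
    (hC.isVonNeumannRegular hA) (g := e.toRingHom) e.injective f]
  congr 1
  ext a
  exact he a

/-- Every real closure * of `A` embeds essentially into a quotient of an epof. -/
theorem exists_isEpof (hB : IsRealClosureStarOf A P B Q f) (hA : IsVonNeumannRegular A) :
    ∃ (K : PrimeSpectrum A → Type u) (_ : ∀ p, Field (K p)) (κ : ∀ p, A →+* K p),
      IsEpof A P K κ ∧ ∃ I : Ideal (∀ p, K p),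
        IsEssentialExtension ((Ideal.Quotient.mk I).comp (RingHom.pi κ)) ∧
        f.squareSpectrum P = ((Ideal.Quotient.mk I).comp (RingHom.pi κ)).squareSpectrum P := by
  have hBv := hB.isVonNeumannRegular hA
  have hroots := hB.hasRealClosedRoots hA
  choose q hq hqp using fun p : PrimeSpectrum A ↦ hA.exists_comap_eq hB.essential.1 p.asIdeal
  have := fun p ↦ hBv.isMaximal (q p)
  let := fun p ↦ Ideal.Quotient.field (q p)
  let κ : ∀ p, A →+* B ⧸ q p := fun p ↦ (Ideal.Quotient.mk (q p)).comp f
  have hK : IsEpof A P (fun p ↦ B ⧸ q p) κ :=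
    { ker := fun p a ↦ by
        rw [← hqp p]
        exact Ideal.Quotient.eq_zero_iff_mem
      rcf := fun p ↦ (hroots.of_surjective
        (Ideal.Quotient.mk_surjective (I := q p))).isRealClosedField
        (hBv.isRealRing_quotient hB.rcs.1 (q p))
      alg := fun p ↦ (hB.integral.trans _ _ (RingHom.isIntegral_of_surjective
        (Ideal.Quotient.mk (q p)) Ideal.Quotient.mk_surjective)).exists_eval₂_eq_zero
      ordext := fun p a ha ↦ by
        obtain ⟨y, hy⟩ := ((hB.mem_pos_iff hA _).mp (hB.mono a ha)).map (Ideal.Quotient.mk (q p))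
        exact ⟨y, by rw [pow_two, ← hy]; rfl⟩ }
  let i : B →+* ∀ p, B ⧸ q p := RingHom.pi fun p ↦ Ideal.Quotient.mk (q p)
  have hi : Function.Injective i := hB.essential.injective_of_comp (hK.injective hA)
  obtain ⟨I, hI⟩ := exists_ideal_isEssentialExtension hi
  have hDv : IsVonNeumannRegular (∀ p, B ⧸ q p) := .pi
  refine ⟨_, _, κ, hK, I, hI.comp hB.essential, ?_⟩
  exact (hroots.squareSpectrum_comp P hBv (hDv.isRealRing_quotient hK.isRealRing I)
    (hDv.of_surjective (Ideal.Quotient.mk_surjective (I := I))) hI.1 f).symm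

end IsRealClosureStarOf

/-- The integral closure of `A` in an essential quotient of an epof is a real closure *. -/
theorem IsEpof.exists_isRealClosureStarOf {A : Type u} [CommRing A] {P : Set A}
    {K : PrimeSpectrum A → Type u} [∀ p, Field (K p)] {κ : ∀ p, A →+* K p}
    (h : IsEpof A P K κ) (hBaer : IsBaerRing A) (hA : IsVonNeumannRegular A)
    {I : Ideal (∀ p, K p)} (hI : IsEssentialExtension ((Ideal.Quotient.mk I).comp (RingHom.pi κ))) :
    ∃ B : RealClosureStar A P, B.emb.squareSpectrum P =
      ((Ideal.Quotient.mk I).comp (RingHom.pi κ)).squareSpectrum P := by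
  have hDv : IsVonNeumannRegular (∀ p, K p) := .pi
  have hv := hDv.of_surjective (Ideal.Quotient.mk_surjective (I := I))
  have hr := hDv.isRealRing_quotient h.isRealRing I
  have hB := hI.isRealClosureStarOf (P := P) hBaer hA hr ((HasRealClosedRoots.pi h.rcf).of_surjective
    Ideal.Quotient.mk_surjective) fun a ha ↦ by
      obtain ⟨y, hy⟩ := h.exists_sq ha
      exact ⟨Ideal.Quotient.mk I y, by rw [← map_pow, hy]; rfl⟩
  refine ⟨⟨_, _, _, hB⟩, ?_⟩
  exact ((hB.hasRealClosedRoots hA).squareSpectrum_comp P (hB.isVonNeumannRegular hA) hr hv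
    (Subring.subtype_injective _) _).symm

end

/-- A real Baer von Neumann regular poring `(A, P)` has a unique real
closure * iff there is a subset `X ⊆ Sper A` such that for every epof `B` of `A` and
every ideal `I` of `B` making `A → B → B / I` an essential extension of `A`, `X` is the
set of those `α ∈ Sper A` for which `ρ(α)` is `A / supp α`-isomorphic to the integral
closure of `A / supp α` in `B / 𝔭` for some prime `𝔭` of `B` containing `I` and the
ideal generated by `supp α`. -/
theorem baer_hasUniqueRealClosureStar_iff
    (A : Type u) [CommRing A] (P : Set A) (hP : IsPartialOrdering P)
    (hreal : IsRealRing A) (hBaer : IsBaerRing A) (hvnr : IsVonNeumannRegular A) :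
    HasUniqueRealClosureStar A P ↔
      ∃ X : Set (RealSpectrum A P),
        ∀ (K : PrimeSpectrum A → Type u) [∀ p, Field (K p)] (κ : ∀ p, A →+* K p),
          IsEpof A P K κ →
          ∀ I : Ideal (∀ p, K p),
            IsEssentialExtension ((Ideal.Quotient.mk I).comp (Pi.ringHom κ)) →
            X = {α : RealSpectrum A P |
              ∃ 𝔭 : Ideal (∀ p, K p), 𝔭.IsPrime ∧ I ≤ 𝔭 ∧
                Ideal.map (Pi.ringHom κ) α.1.support ≤ 𝔭 ∧
                Nonempty (RhoIsoIntegralClosure A α.1 ((∀ p, K p) ⧸ 𝔭)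
                  ((Ideal.Quotient.mk 𝔭).comp (Pi.ringHom κ)))} := by
  constructor
  · rintro ⟨⟨B⟩, huniq⟩
    refine ⟨B.emb.squareSpectrum P, fun K _ κ hK I hI ↦ ?_⟩
    obtain ⟨C, hC⟩ := hK.exists_isRealClosureStarOf hBaer hvnr hI
    obtain ⟨e, he, -⟩ := huniq B C
    rw [B.is.squareSpectrum_eq_of_ringEquiv C.is hvnr e he, hC]
    exact (hK.setOf_rhoIso_eq_squareSpectrum hvnr I).symm
  · rintro ⟨X, hX⟩
    have key : ∀ B : RealClosureStar A P, B.emb.squareSpectrum P = X := fun B ↦ by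
      obtain ⟨K, _, κ, hK, I, hI, hB⟩ := B.is.exists_isEpof hvnr
      rw [hB, hX K κ hK I hI]
      exact (hK.setOf_rhoIso_eq_squareSpectrum hvnr I).symm
    refine ⟨?_, fun B C ↦ B.is.exists_ringEquiv_of_squareSpectrum_eq C.is hvnr
      ((key B).trans (key C).symm)⟩
    obtain ⟨K, _, κ, hK⟩ := hP.exists_isEpof hvnr
    obtain ⟨I, hI⟩ := exists_ideal_isEssentialExtension (hK.injective hvnr)
    obtain ⟨B, -⟩ := hK.exists_isRealClosureStarOf hBaer hvnr hI
    exact ⟨B⟩
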